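/- Assume 6·π1·π2 < 1 and 1/2 ≤ d·θ² ≤ 1. There exist N = N(π) and δ = δ(π, d) > 0 such that for every n ≥ N with x_n ≤ δ: x_{n+1} ≥ d·θ²·x_n + (1/2)·((1 − 6π1π2)/(π1·π2²))·(d(d−1)/2)·θ⁴·x_n². -/

import Mathlib

open Finset Filter

namespace AsymIsing

/-- Level-`k` vertices of the rooted `d`-ary tree: paths of length `k` from the root. -/
abbrev Vert (d k : ℕ) : Type := Fin k → Fin d

/-- A spin configuration on levels `0, …, n` of the `d`-ary tree. -/
abbrev Conf (d n : ℕ) : Type := ∀ k : Fin (n + 1), Vert d k → Fin 2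

/-- A spin configuration on level `n` only. -/
abbrev LConf (d n : ℕ) : Type := Vert d n → Fin 2

/-- The transition matrix of the asymmetric binary channel; the paper's state `1`
corresponds to the index `0` and the state `2` to the index `1`. -/
noncomputable def Mmat (θ Δ : ℝ) : Fin 2 → Fin 2 → ℝ := fun i j =>
  if i = 0 then (if j = 0 then (1 + θ - Δ) / 2 else (1 - θ + Δ) / 2)
  else (if j = 0 then (1 - θ - Δ) / 2 else (1 + θ + Δ) / 2)

/-- The stationary distribution `π = (π₁, π₂)` of the channel. -/
noncomputable def pst (θ Δ : ℝ) : Fin 2 → ℝ := fun i =>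
  if i = 0 then 1 / 2 - Δ / (2 * (1 - θ)) else 1 / 2 + Δ / (2 * (1 - θ))

/-- The root spin of a configuration. -/
def root {d n : ℕ} (σ : Conf d n) : Fin 2 := σ ⟨0, n.succ_pos⟩ (fun i => i.elim0)

/-- The restriction of a configuration to the last (`n`-th) level. -/
def top {d n : ℕ} (σ : Conf d n) : LConf d n := σ (Fin.last n)

/-- The probability of a full configuration on levels `0, …, n` under the broadcast
process: the root is drawn from `π` and spins propagate along edges via `M`. -/
noncomputable def confProb (d : ℕ) (θ Δ : ℝ) (n : ℕ) (σ : Conf d n) : ℝ :=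
  pst θ Δ (root σ) *
    ∏ k : Fin n, ∏ v : Vert d (k + 1),
      Mmat θ Δ (σ k.castSucc (v ∘ Fin.castSucc)) (σ k.succ v)

/-- `P(σ(n) = A)`: the marginal law of the level-`n` spins. -/
noncomputable def levelProb (d : ℕ) (θ Δ : ℝ) (n : ℕ) (A : LConf d n) : ℝ :=
  ∑ σ : Conf d n, if top σ = A then confProb d θ Δ n σ else 0

/-- `P(σ_ρ = i, σ(n) = A)`. -/
noncomputable def jointProb (d : ℕ) (θ Δ : ℝ) (n : ℕ) (i : Fin 2) (A : LConf d n) : ℝ :=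
  ∑ σ : Conf d n, if root σ = i ∧ top σ = A then confProb d θ Δ n σ else 0

/-- The posterior `f_n(i, A) = P(σ_ρ = i ∣ σ(n) = A)`. -/
noncomputable def post (d : ℕ) (θ Δ : ℝ) (n : ℕ) (i : Fin 2) (A : LConf d n) : ℝ :=
  jointProb d θ Δ n i A / levelProb d θ Δ n A

/-- The law of `σ^i(n)`, i.e. `P(σ(n) = A ∣ σ_ρ = i)`. -/
noncomputable def condLevel (d : ℕ) (θ Δ : ℝ) (n : ℕ) (i : Fin 2) (A : LConf d n) : ℝ :=
  jointProb d θ Δ n i A / pst θ Δ i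

/-- The total variation distance between `σ^1(n)` and `σ^2(n)`. -/
noncomputable def tvDist (d : ℕ) (θ Δ : ℝ) (n : ℕ) : ℝ :=
  (1 / 2) * ∑ A : LConf d n, |condLevel d θ Δ n 0 A - condLevel d θ Δ n 1 A|

/-- The reconstruction problem is solvable if `limsup_n d_TV(σ^1(n), σ^2(n)) > 0`. -/
def solvable (d : ℕ) (θ Δ : ℝ) : Prop :=
  0 < Filter.limsup (fun n => tvDist d θ Δ n) Filter.atTop

/-- Non-reconstruction: `limsup_n d_TV(σ^1(n), σ^2(n)) = 0`. -/
def nonReconstruction (d : ℕ) (θ Δ : ℝ) : Prop :=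
  Filter.limsup (fun n => tvDist d θ Δ n) Filter.atTop = 0

/-- Expectation of a function of the level-`n` configuration, conditioned on `σ_ρ = 1`. -/
noncomputable def expect1 (d : ℕ) (θ Δ : ℝ) (n : ℕ) (g : LConf d n → ℝ) : ℝ :=
  ∑ A : LConf d n, condLevel d θ Δ n 0 A * g A

/-- `x_n = E f_n(1, σ^1(n)) − π₁`. -/
noncomputable def xseq (d : ℕ) (θ Δ : ℝ) (n : ℕ) : ℝ :=
  expect1 d θ Δ n (fun A => post d θ Δ n 0 A) - pst θ Δ 0

/-- `z_n = E (f_n(1, σ^1(n)) − π₁)²`. -/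
noncomputable def zseq (d : ℕ) (θ Δ : ℝ) (n : ℕ) : ℝ :=
  expect1 d θ Δ n (fun A => (post d θ Δ n 0 A - pst θ Δ 0) ^ 2)

/-- The restriction of a level-`(n+1)` configuration to the subtree of the `j`-th
child of the root (paths starting with `j`). -/
def restrictChild {d n : ℕ} (j : Fin d) (A : LConf d (n + 1)) : LConf d n :=
  fun w => A (Fin.cons j w)

/-- `Y_j = f_n(1, σ_j(n+1))`, as a function of the level-`(n+1)` configuration. -/
noncomputable def Yfun (d : ℕ) (θ Δ : ℝ) (n : ℕ) (j : Fin d) (A : LConf d (n + 1)) : ℝ :=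
  post d θ Δ n 0 (restrictChild j A)

/-- `Z₁ = ∏_j (1 + (θ/π₁)(Y_j − π₁))`, as a function of the level-`(n+1)` configuration. -/
noncomputable def Z1fun (d : ℕ) (θ Δ : ℝ) (n : ℕ) (A : LConf d (n + 1)) : ℝ :=
  ∏ j : Fin d, (1 + (θ / pst θ Δ 0) * (Yfun d θ Δ n j A - pst θ Δ 0))

/-- `Z₂ = ∏_j (1 − (θ/π₂)(Y_j − π₁))`, as a function of the level-`(n+1)` configuration. -/
noncomputable def Z2fun (d : ℕ) (θ Δ : ℝ) (n : ℕ) (A : LConf d (n + 1)) : ℝ :=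
  ∏ j : Fin d, (1 - (θ / pst θ Δ 1) * (Yfun d θ Δ n j A - pst θ Δ 0))

/-- The value of `Δ` making `π = (π₁, π₂)` the stationary distribution of the channel
with second eigenvalue `θ`, namely `Δ = (1 − θ)(π₂ − π₁)`. -/
noncomputable def Dlt (θ π1 π2 : ℝ) : ℝ := (1 - θ) * (π2 - π1)

/-- The Gaussian-approximation function
`f(s) = E[π₁ e^{sμ₁+√s W₁} / (π₁ e^{sμ₁+√s W₁} + π₂ e^{sμ₂+√s W₂})] − π₁`,
where `μ₁ = 1/(2π₁)`, `μ₂ = −(1+π₂)/(2π₂²)`, `W₁ ∼ N(0, 1/π₁)` (realized as `w/√π₁`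
for `w` standard Gaussian) and `W₂ = −(π₁/π₂)·W₁`. -/
noncomputable def gfun (π1 π2 : ℝ) (s : ℝ) : ℝ :=
  (∫ w : ℝ,
      (π1 * Real.exp (s * (1 / (2 * π1)) + Real.sqrt s * (w / Real.sqrt π1))) /
        (π1 * Real.exp (s * (1 / (2 * π1)) + Real.sqrt s * (w / Real.sqrt π1)) +
          π2 * Real.exp (s * (-(1 + π2) / (2 * π2 ^ 2)) +
            Real.sqrt s * (-(π1 / π2) * (w / Real.sqrt π1))))
    ∂(ProbabilityTheory.gaussianReal 0 1)) - π1


/-- The product of the transition probabilities along all edges of a configuration. -/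
noncomputable def edgeWeight (d : ℕ) (θ Δ : ℝ) (n : ℕ) (σ : Conf d n) : ℝ :=
  ∏ k : Fin n, ∏ v : Vert d (k + 1),
    Mmat θ Δ (σ k.castSucc (v ∘ Fin.castSucc)) (σ k.succ v)

/-- The likelihood of the level-`n` configuration `A` given that the root has state `i`. -/
noncomputable def lik (d : ℕ) (θ Δ : ℝ) (n : ℕ) (i : Fin 2) (A : LConf d n) : ℝ :=
  ∑ σ : Conf d n, if root σ = i ∧ top σ = A then edgeWeight d θ Δ n σ else 0

/-- A configuration on `n + 1` levels is a root spin together with a configuration on `n`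
levels for each child of the root. -/
def confEquiv (d n : ℕ) : Conf d (n + 1) ≃ Fin 2 × (Fin d → Conf d n) where
  toFun σ := (root σ, fun j k w => σ k.succ (Fin.cons j w : Vert d (k + 1)))
  invFun x := Fin.cons (fun _ => x.1) (fun k (v : Vert d (k + 1)) => x.2 (v 0) k (Fin.tail v))
  left_inv σ := by
    funext k
    refine Fin.cases ?_ (fun k => ?_) k
    · funext v
      simp only [root, Fin.cons_zero]
      exact congrArg _ (Subsingleton.elim (α := Fin 0 → Fin d) _ _)
    · funext v
      simp only [Fin.cons_succ]
      exact congrArg _ (Fin.cons_self_tail (α := fun _ => Fin d) v)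
  right_inv x := by
    ext1
    · rfl
    · rfl

/-- A level-`(n+1)` configuration is a family of level-`n` configurations indexed by the
children of the root. -/
def levelEquiv (d n : ℕ) : LConf d (n + 1) ≃ (Fin d → LConf d n) where
  toFun A j := restrictChild j A
  invFun B v := B (v 0) (Fin.tail v)
  left_inv A := by
    funext v
    exact congrArg A (Fin.cons_self_tail (α := fun _ => Fin d) v)
  right_inv B := rfl

lemma edgeWeight_confEquiv_symm (d : ℕ) (θ Δ : ℝ) (n : ℕ) (i : Fin 2) (s : Fin d → Conf d n) :
    edgeWeight d θ Δ (n + 1) ((confEquiv d n).symm (i, s)) =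
      ∏ j, (Mmat θ Δ i (root (s j)) * edgeWeight d θ Δ n (s j)) := by
  have reindex : ∀ (m : ℕ) (f : Vert d (m + 1) → ℝ),
      ∏ v, f v = ∏ j, ∏ w : Vert d m, f (Fin.cons j w : Vert d (m + 1)) := by
    intro m f
    rw [← Fintype.prod_prod_type']
    exact (Fintype.prod_equiv (Fin.consEquiv (fun _ : Fin (m + 1) => Fin d)) _ _
      (fun _ => rfl)).symm
  unfold edgeWeight
  rw [Fin.prod_univ_succ, Finset.prod_mul_distrib]
  congr 1
  · refine (reindex 0 _).trans (Finset.prod_congr rfl fun j _ => ?_)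
    refine (Fintype.prod_unique _).trans ?_
    change Mmat θ Δ i (s j 0 _) = Mmat θ Δ i (s j _ _)
    congr 1
  · refine Eq.trans (Finset.prod_congr rfl fun k _ => ?_) Finset.prod_comm
    refine (reindex (k + 1) _).trans (Finset.prod_congr rfl fun j _ =>
      Finset.prod_congr rfl fun w _ => ?_)
    rfl

lemma lik_succ (d : ℕ) (θ Δ : ℝ) (n : ℕ) (i : Fin 2) (A : LConf d (n + 1)) :
    lik d θ Δ (n + 1) i A =
      ∏ j, ∑ k, Mmat θ Δ i k * lik d θ Δ n k (restrictChild j A) := by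
  have hroot : ∀ x : Fin 2 × (Fin d → Conf d n), root ((confEquiv d n).symm x) = x.1 :=
    fun _ => rfl
  have htop : ∀ x : Fin 2 × (Fin d → Conf d n),
      top ((confEquiv d n).symm x) = A ↔ ∀ j, top (x.2 j) = restrictChild j A := by
    intro x
    rw [← (levelEquiv d n).apply_eq_iff_eq, funext_iff]
    rfl
  have hfactor : ∀ B : LConf d n, ∑ k, Mmat θ Δ i k * lik d θ Δ n k B =
      ∑ σ : Conf d n, if top σ = B then Mmat θ Δ i (root σ) * edgeWeight d θ Δ n σ else 0 := by
    intro B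
    simp only [lik, Finset.mul_sum]
    rw [Finset.sum_comm]
    refine Finset.sum_congr rfl fun σ _ => ?_
    by_cases h : top σ = B <;> simp [h]
  simp only [hfactor]
  rw [Finset.prod_univ_sum, lik, ← (confEquiv d n).symm.sum_comp, Fintype.sum_prod_type,
    Finset.sum_eq_single i, Fintype.piFinset_univ]
  · refine Finset.sum_congr rfl fun s _ => ?_
    rw [Finset.prod_ite_zero]
    simp only [hroot, htop, edgeWeight_confEquiv_symm, true_and, Finset.mem_univ, true_imp_iff]
  · intro b _ hb
    refine Finset.sum_eq_zero fun s _ => ?_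
    rw [if_neg]
    simp [hroot, hb]
  · simp

lemma jointProb_eq (d : ℕ) (θ Δ : ℝ) (n : ℕ) (i : Fin 2) (A : LConf d n) :
    jointProb d θ Δ n i A = pst θ Δ i * lik d θ Δ n i A := by
  unfold jointProb lik
  rw [Finset.mul_sum]
  refine Finset.sum_congr rfl fun σ _ => ?_
  split_ifs with h
  · simp only [confProb, edgeWeight, h.1]
  · simp

lemma levelProb_eq (d : ℕ) (θ Δ : ℝ) (n : ℕ) (A : LConf d n) :
    levelProb d θ Δ n A =
      pst θ Δ 0 * lik d θ Δ n 0 A + pst θ Δ 1 * lik d θ Δ n 1 A := by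
  rw [← jointProb_eq, ← jointProb_eq]
  unfold levelProb jointProb
  rw [← Finset.sum_add_distrib]
  refine Finset.sum_congr rfl fun σ _ => ?_
  have : root σ = 0 ∨ root σ = 1 := by omega
  by_cases h : top σ = A <;> rcases this with h' | h' <;> simp [h, h']

lemma lik_zero (d : ℕ) (θ Δ : ℝ) (i : Fin 2) (A : LConf d 0) :
    lik d θ Δ 0 i A = if A (fun i => i.elim0) = i then 1 else 0 := by
  let e : Conf d 0 ≃ LConf d 0 :=
    { toFun := fun σ => σ 0
      invFun := fun A => Fin.cons A (fun k => k.elim0)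
      left_inv := fun σ => by
        funext k
        refine Fin.cases ?_ (fun k => k.elim0) k
        rfl
      right_inv := fun A => rfl }
  rw [lik, ← e.symm.sum_comp, Finset.sum_eq_single A]
  · have : top (e.symm A) = A := rfl
    have h2 : root (e.symm A) = A (fun i => i.elim0) := rfl
    simp [this, h2, edgeWeight]
  · intro B _ hB
    have : top (e.symm B) = B := rfl
    simp [this, hB]
  · simp

lemma sum_mul_pos_of_add_pos {m l : Fin 2 → ℝ} (hm : ∀ k, 0 < m k) (hl : ∀ k, 0 ≤ l k)
    (hpos : 0 < l 0 + l 1) : 0 < ∑ k, m k * l k := by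
  rw [Fin.sum_univ_two]
  rcases (hl 0).eq_or_lt with h0 | h0
  · exact add_pos_of_nonneg_of_pos (mul_nonneg (hm 0).le (hl 0)) (mul_pos (hm 1) (by linarith))
  · exact add_pos_of_pos_of_nonneg (mul_pos (hm 0) h0) (mul_nonneg (hm 1).le (hl 1))

lemma lik_nonneg_and_pos {d : ℕ} {θ Δ : ℝ} (hM : ∀ i j, 0 < Mmat θ Δ i j) (n : ℕ)
    (A : LConf d n) :
    (∀ i, 0 ≤ lik d θ Δ n i A) ∧ 0 < lik d θ Δ n 0 A + lik d θ Δ n 1 A := by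
  induction n with
  | zero =>
    simp only [lik_zero]
    refine ⟨fun i => by split_ifs <;> norm_num, ?_⟩
    have : A (fun i => i.elim0) = 0 ∨ A (fun i => i.elim0) = 1 := by omega
    rcases this with h | h <;> simp [h]
  | succ n ih =>
    have key : ∀ i, 0 < lik d θ Δ (n + 1) i A := by
      intro i
      rw [lik_succ]
      exact Finset.prod_pos fun j _ =>
        sum_mul_pos_of_add_pos (hM i) (ih (restrictChild j A)).1 (ih (restrictChild j A)).2
    exact ⟨fun i => (key i).le, add_pos (key 0) (key 1)⟩

lemma sum_Mmat_mul_lik_pos {d : ℕ} {θ Δ : ℝ} (hM : ∀ i j, 0 < Mmat θ Δ i j) (n : ℕ)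
    (i : Fin 2) (A : LConf d n) : 0 < ∑ k, Mmat θ Δ i k * lik d θ Δ n k A :=
  sum_mul_pos_of_add_pos (hM i) (lik_nonneg_and_pos hM n A).1 (lik_nonneg_and_pos hM n A).2

lemma Mmat_row_sum (θ Δ : ℝ) (i : Fin 2) : Mmat θ Δ i 0 + Mmat θ Δ i 1 = 1 := by
  unfold Mmat
  split_ifs <;> simp_all <;> ring

lemma sum_lik (d : ℕ) (θ Δ : ℝ) (n : ℕ) (i : Fin 2) : ∑ A, lik d θ Δ n i A = 1 := by
  induction n generalizing i with
  | zero =>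
    simp only [lik_zero]
    rw [Finset.sum_eq_single (fun _ => i)]
    · simp
    · intro A _ hA
      rw [if_neg]
      intro h
      apply hA
      funext v
      rw [← h]
      exact congrArg A (Subsingleton.elim (α := Fin 0 → Fin d) _ _)
    · simp
  | succ n ih =>
    simp only [lik_succ]
    have h := Fintype.sum_pow (fun B => ∑ k, Mmat θ Δ i k * lik d θ Δ n k B) d
    rw [← (levelEquiv d n).sum_comp] at h
    refine h.symm.trans ?_
    rw [Finset.sum_comm]
    simp [← Finset.mul_sum, ih, Fin.sum_univ_two, Mmat_row_sum]

section ProductStep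

variable {Ω : Type*} [Fintype Ω]

/-- A finite law `p` together with a centered random variable `U` bounded by one. -/
structure CenteredLaw (p U : Ω → ℝ) : Prop where
  nonneg : ∀ ω, 0 ≤ p ω
  sum_eq_one : ∑ ω, p ω = 1
  mean_zero : ∑ ω, p ω * U ω = 0
  abs_le_one : ∀ ω, |U ω| ≤ 1

/-- The `k`-th moment of `U` under `p`. -/
noncomputable def moment (p U : Ω → ℝ) (k : ℕ) : ℝ := ∑ ω, p ω * U ω ^ k

/-- The expectation of `G` under `d` independent samples from `p`. -/
noncomputable def prodAvg (d : ℕ) (p : Ω → ℝ) (G : (Fin d → Ω) → ℝ) : ℝ :=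
  ∑ B : Fin d → Ω, (∏ j, p (B j)) * G B

/-- The product `∏ⱼ (1 + c Uⱼ)`. -/
noncomputable def affProd (d : ℕ) (U : Ω → ℝ) (c : ℝ) (B : Fin d → Ω) : ℝ :=
  ∏ j, (1 + c * U (B j))

lemma prodAvg_mono {d : ℕ} {p : Ω → ℝ} (hp : ∀ ω, 0 ≤ p ω) {G H : (Fin d → Ω) → ℝ}
    (h : ∀ B, G B ≤ H B) : prodAvg d p G ≤ prodAvg d p H :=
  Finset.sum_le_sum fun B _ =>
    mul_le_mul_of_nonneg_left (h B) (Finset.prod_nonneg fun j _ => hp (B j))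

lemma prodAvg_add (d : ℕ) (p : Ω → ℝ) (G H : (Fin d → Ω) → ℝ) :
    prodAvg d p (fun B => G B + H B) = prodAvg d p G + prodAvg d p H := by
  simp only [prodAvg, mul_add, Finset.sum_add_distrib]

lemma prodAvg_const_mul (d : ℕ) (p : Ω → ℝ) (c : ℝ) (G : (Fin d → Ω) → ℝ) :
    prodAvg d p (fun B => c * G B) = c * prodAvg d p G := by
  simp only [prodAvg, Finset.mul_sum]
  exact Finset.sum_congr rfl fun B _ => by ring

lemma prodAvg_sub (d : ℕ) (p : Ω → ℝ) (G H : (Fin d → Ω) → ℝ) :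
    prodAvg d p (fun B => G B - H B) = prodAvg d p G - prodAvg d p H := by
  simp only [prodAvg, mul_sub, Finset.sum_sub_distrib]

lemma abs_prodAvg_le {d : ℕ} {p : Ω → ℝ} (hp : ∀ ω, 0 ≤ p ω) (G : (Fin d → Ω) → ℝ) :
    |prodAvg d p G| ≤ prodAvg d p (fun B => |G B|) := by
  refine (Finset.abs_sum_le_sum_abs _ _).trans (Finset.sum_le_sum fun B _ => ?_)
  rw [abs_mul, abs_of_nonneg (Finset.prod_nonneg fun j _ => hp (B j))]

lemma prodAvg_affProd_pow (d : ℕ) (p U : Ω → ℝ) (c c' : ℝ) (a b : ℕ) :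
    prodAvg d p (fun B => affProd d U c B ^ a * affProd d U c' B ^ b) =
      (∑ ω, p ω * ((1 + c * U ω) ^ a * (1 + c' * U ω) ^ b)) ^ d := by
  rw [Fintype.sum_pow]
  simp only [prodAvg, affProd, ← Finset.prod_pow, ← Finset.prod_mul_distrib]

lemma prodAvg_affProd_mul {d : ℕ} {p U : Ω → ℝ} (h : CenteredLaw p U) (c : ℝ) (j : Fin d)
    (g : Ω → ℝ) :
    prodAvg d p (fun B => affProd d U c B * g (B j)) = ∑ ω, p ω * ((1 + c * U ω) * g ω) := by
  classical
  have h1 : ∑ ω, p ω * (1 + c * U ω) = 1 := by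
    have : ∑ ω, p ω * (1 + c * U ω) = ∑ ω, p ω + c * ∑ ω, p ω * U ω := by
      rw [Finset.mul_sum, ← Finset.sum_add_distrib]
      exact Finset.sum_congr rfl fun ω _ => by ring
    rw [this, h.sum_eq_one, h.mean_zero]; ring
  have h2 := Finset.prod_univ_sum (fun _ : Fin d => (Finset.univ : Finset Ω))
    (fun i ω => p ω * ((1 + c * U ω) * (if i = j then g ω else 1)))
  have h3 : ∀ i, ∑ ω, p ω * ((1 + c * U ω) * (if i = j then g ω else 1)) =
      if i = j then ∑ ω, p ω * ((1 + c * U ω) * g ω) else 1 := by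
    intro i
    split_ifs with hi
    · rfl
    · simpa using h1
  simp only [h3, Finset.prod_ite_eq', Finset.mem_univ, if_true, Fintype.piFinset_univ,
    Finset.prod_mul_distrib] at h2
  rw [h2]
  rfl

/-- The mixture `π₁ Z₁ + π₂ Z₂` of the two likelihood ratios. -/
noncomputable def mixSum (d : ℕ) (π1 π2 θ : ℝ) (U : Ω → ℝ) (B : Fin d → Ω) : ℝ :=
  π1 * affProd d U (θ / π1) B + π2 * affProd d U (-(θ / π2)) B

/-- The difference `Z₁ - Z₂` of the two likelihood ratios. -/
noncomputable def ratioDiff (d : ℕ) (π1 π2 θ : ℝ) (U : Ω → ℝ) (B : Fin d → Ω) : ℝ :=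
  affProd d U (θ / π1) B - affProd d U (-(θ / π2)) B

/-- The `k`-th moment of the centered posterior one level further from the root. -/
noncomputable def nextMoment (d : ℕ) (π1 π2 θ : ℝ) (p U : Ω → ℝ) (k : ℕ) : ℝ :=
  prodAvg d p fun B => mixSum d π1 π2 θ U B *
    (π1 * π2 * ratioDiff d π1 π2 θ U B / mixSum d π1 π2 θ U B) ^ k

/-- The law of the child posteriors is centered and gives positive likelihood ratios. -/
structure StepData (π1 π2 θ : ℝ) (p U : Ω → ℝ) : Prop extends CenteredLaw p U where
  sum_pi : π1 + π2 = 1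
  pi1_pos : 0 < π1
  pi2_pos : 0 < π2
  fac1_pos : ∀ ω, 0 < 1 + θ / π1 * U ω
  fac2_pos : ∀ ω, 0 < 1 + -(θ / π2) * U ω

variable {π1 π2 θ : ℝ} {p U : Ω → ℝ}

lemma StepData.affProd1_pos (h : StepData π1 π2 θ p U) (d : ℕ) (B : Fin d → Ω) :
    0 < affProd d U (θ / π1) B :=
  Finset.prod_pos fun j _ => h.fac1_pos (B j)

lemma StepData.affProd2_pos (h : StepData π1 π2 θ p U) (d : ℕ) (B : Fin d → Ω) :
    0 < affProd d U (-(θ / π2)) B :=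
  Finset.prod_pos fun j _ => h.fac2_pos (B j)

lemma StepData.mixSum_pos (h : StepData π1 π2 θ p U) (d : ℕ) (B : Fin d → Ω) :
    0 < mixSum d π1 π2 θ U B :=
  add_pos (mul_pos h.pi1_pos (h.affProd1_pos d B)) (mul_pos h.pi2_pos (h.affProd2_pos d B))

lemma StepData.mul_sq_div (h : StepData π1 π2 θ p U) (d : ℕ) (B : Fin d → Ω) :
    mixSum d π1 π2 θ U B *
      (π1 * π2 * ratioDiff d π1 π2 θ U B / mixSum d π1 π2 θ U B) ^ 2 =
      (π1 * π2) ^ 2 * (ratioDiff d π1 π2 θ U B ^ 2 / mixSum d π1 π2 θ U B) := by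
  have := (h.mixSum_pos d B).ne'
  field_simp

lemma StepData.theta_sq_mul_moment_le (h : StepData π1 π2 θ p U) {d : ℕ} (j : Fin d) :
    θ ^ 2 * moment p U 2 ≤ nextMoment d π1 π2 θ p U 2 := by
  have h1 := h.pi1_pos
  have h2 := h.pi2_pos
  have hD : prodAvg d p (fun B => ratioDiff d π1 π2 θ U B * U (B j)) =
      θ / (π1 * π2) * moment p U 2 := by
    simp only [ratioDiff, sub_mul]
    rw [prodAvg_sub, prodAvg_affProd_mul h.toCenteredLaw, prodAvg_affProd_mul h.toCenteredLaw,
      ← Finset.sum_sub_distrib, moment, Finset.mul_sum]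
    refine Finset.sum_congr rfl fun ω _ => ?_
    field_simp
    linear_combination θ * p ω * U ω ^ 2 * h.sum_pi
  have hS : prodAvg d p (fun B => mixSum d π1 π2 θ U B * U (B j) ^ 2) = moment p U 2 := by
    simp only [mixSum, add_mul, mul_assoc]
    rw [prodAvg_add, prodAvg_const_mul, prodAvg_const_mul,
      prodAvg_affProd_mul h.toCenteredLaw _ _ (fun ω => U ω ^ 2),
      prodAvg_affProd_mul h.toCenteredLaw _ _ (fun ω => U ω ^ 2), Finset.mul_sum,
      Finset.mul_sum, ← Finset.sum_add_distrib, moment]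
    refine Finset.sum_congr rfl fun ω _ => ?_
    field_simp
    linear_combination p ω * U ω ^ 2 * h.sum_pi
  have hle : prodAvg d p (fun B => 2 * (π1 * π2 * θ) * (ratioDiff d π1 π2 θ U B * U (B j)) -
      θ ^ 2 * (mixSum d π1 π2 θ U B * U (B j) ^ 2)) ≤ nextMoment d π1 π2 θ p U 2 := by
    refine prodAvg_mono h.nonneg fun B => ?_
    rw [h.mul_sq_div]
    have hS := h.mixSum_pos d B
    set S := mixSum d π1 π2 θ U B
    set D := ratioDiff d π1 π2 θ U B
    have : (π1 * π2) ^ 2 * (D ^ 2 / S) - (2 * (π1 * π2 * θ) * (D * U (B j)) -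
        θ ^ 2 * (S * U (B j) ^ 2)) = (π1 * π2 * D - θ * S * U (B j)) ^ 2 / S := by
      field_simp
      ring
    have : 0 ≤ (π1 * π2 * D - θ * S * U (B j)) ^ 2 / S := by positivity
    linarith
  rw [prodAvg_sub, prodAvg_const_mul, prodAvg_const_mul, hD, hS] at hle
  have : 2 * (π1 * π2 * θ) * (θ / (π1 * π2) * moment p U 2) = 2 * (θ ^ 2 * moment p U 2) := by
    field_simp
  linarith

lemma StepData.sum_mul_eq (h : StepData π1 π2 θ p U) (c c2 c3 : ℝ) (f : Ω → ℝ)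
    (hf : ∀ ω, f ω = 1 + c * U ω + c2 * U ω ^ 2 + c3 * U ω ^ 3) :
    ∑ ω, p ω * f ω = 1 + (c2 * moment p U 2 + c3 * moment p U 3) := by
  have : ∑ ω, p ω * f ω = ∑ ω, p ω + c * ∑ ω, p ω * U ω +
      c2 * moment p U 2 + c3 * moment p U 3 := by
    simp only [moment, Finset.mul_sum, ← Finset.sum_add_distrib]
    refine Finset.sum_congr rfl fun ω _ => ?_
    rw [hf]; ring
  rw [this, h.sum_eq_one, h.mean_zero]; ring

lemma StepData.prodAvg_mul_pow (h : StepData π1 π2 θ p U) (d a b : ℕ) (c c2 c3 : ℝ)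
    (hf : ∀ u : ℝ, (1 + θ / π1 * u) ^ a * (1 + -(θ / π2) * u) ^ b =
      1 + c * u + c2 * u ^ 2 + c3 * u ^ 3) :
    prodAvg d p (fun B => affProd d U (θ / π1) B ^ a * affProd d U (-(θ / π2)) B ^ b) =
      (1 + (c2 * moment p U 2 + c3 * moment p U 3)) ^ d := by
  rw [prodAvg_affProd_pow, h.sum_mul_eq c c2 c3 _ fun ω => hf (U ω)]

/-- The deviation from one of the single-child expectation of `(1 + θU/π₁)ᵃ (1 - θU/π₂)ᵇ`,
in terms of `s = θ² E U²` and `τ = θ³ E U³`. -/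
noncomputable def mixedCoeff (a b : ℕ) (π1 π2 s τ : ℝ) : ℝ :=
  (a * (a - 1) / 2 / π1 ^ 2 - a * b / (π1 * π2) + b * (b - 1) / 2 / π2 ^ 2) * s +
    (a * (a - 1) * (a - 2) / 6 / π1 ^ 3 - a * (a - 1) / 2 * b / (π1 ^ 2 * π2) +
      a * (b * (b - 1) / 2) / (π1 * π2 ^ 2) - b * (b - 1) * (b - 2) / 6 / π2 ^ 3) * τ

/-- The expectation `E Z₁ᵃ Z₂ᵇ` for `a + b ≤ 3`, in terms of `s = θ² E U²` and `τ = θ³ E U³`. -/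
noncomputable def mixedMoment (d a b : ℕ) (π1 π2 s τ : ℝ) : ℝ :=
  (1 + mixedCoeff a b π1 π2 s τ) ^ d

lemma StepData.prodAvg_eq_mixedMoment (h : StepData π1 π2 θ p U) (d a b : ℕ)
    (hab : a + b ≤ 3) :
    prodAvg d p (fun B => affProd d U (θ / π1) B ^ a * affProd d U (-(θ / π2)) B ^ b) =
      mixedMoment d a b π1 π2 (θ ^ 2 * moment p U 2) (θ ^ 3 * moment p U 3) := by
  have h1 := h.pi1_pos.ne'
  have h2 := h.pi2_pos.ne'
  rw [h.prodAvg_mul_pow d a b (a * (θ / π1) - b * (θ / π2))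
    ((a * (a - 1) / 2 / π1 ^ 2 - a * b / (π1 * π2) + b * (b - 1) / 2 / π2 ^ 2) * θ ^ 2)
    ((a * (a - 1) * (a - 2) / 6 / π1 ^ 3 - a * (a - 1) / 2 * b / (π1 ^ 2 * π2) +
      a * (b * (b - 1) / 2) / (π1 * π2 ^ 2) - b * (b - 1) * (b - 2) / 6 / π2 ^ 3) * θ ^ 3)]
  · unfold mixedMoment mixedCoeff
    congr 2
    ring
  · intro u
    have ha : a ≤ 3 := by omega
    have hb : b ≤ 3 := by omega
    interval_cases a <;> interval_cases b <;> first | omega | (push_cast; ring)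

lemma StepData.prodAvg_ratioDiff_sq (h : StepData π1 π2 θ p U) (d : ℕ) :
    prodAvg d p (fun B => ratioDiff d π1 π2 θ U B ^ 2) =
      mixedMoment d 2 0 π1 π2 (θ ^ 2 * moment p U 2) (θ ^ 3 * moment p U 3) -
        2 * mixedMoment d 1 1 π1 π2 (θ ^ 2 * moment p U 2) (θ ^ 3 * moment p U 3) +
        mixedMoment d 0 2 π1 π2 (θ ^ 2 * moment p U 2) (θ ^ 3 * moment p U 3) := by
  rw [← h.prodAvg_eq_mixedMoment d 2 0 (by norm_num),
    ← h.prodAvg_eq_mixedMoment d 1 1 (by norm_num),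
    ← h.prodAvg_eq_mixedMoment d 0 2 (by norm_num), ← prodAvg_const_mul, ← prodAvg_sub,
    ← prodAvg_add]
  congr 1
  funext B
  unfold ratioDiff
  ring

lemma StepData.prodAvg_ratioDiff_cube (h : StepData π1 π2 θ p U) (d : ℕ) :
    prodAvg d p (fun B => ratioDiff d π1 π2 θ U B ^ 3) =
      mixedMoment d 3 0 π1 π2 (θ ^ 2 * moment p U 2) (θ ^ 3 * moment p U 3) -
        3 * mixedMoment d 2 1 π1 π2 (θ ^ 2 * moment p U 2) (θ ^ 3 * moment p U 3) +
        3 * mixedMoment d 1 2 π1 π2 (θ ^ 2 * moment p U 2) (θ ^ 3 * moment p U 3) -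
        mixedMoment d 0 3 π1 π2 (θ ^ 2 * moment p U 2) (θ ^ 3 * moment p U 3) := by
  rw [← h.prodAvg_eq_mixedMoment d 3 0 (by norm_num),
    ← h.prodAvg_eq_mixedMoment d 2 1 (by norm_num),
    ← h.prodAvg_eq_mixedMoment d 1 2 (by norm_num),
    ← h.prodAvg_eq_mixedMoment d 0 3 (by norm_num), ← prodAvg_const_mul, ← prodAvg_const_mul,
    ← prodAvg_sub, ← prodAvg_add, ← prodAvg_sub]
  congr 1
  funext B
  unfold ratioDiff
  ring

lemma StepData.prodAvg_ratioDiff_sq_mul_mixSum (h : StepData π1 π2 θ p U) (d : ℕ) :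
    prodAvg d p (fun B => ratioDiff d π1 π2 θ U B ^ 2 * mixSum d π1 π2 θ U B) =
      π1 * mixedMoment d 3 0 π1 π2 (θ ^ 2 * moment p U 2) (θ ^ 3 * moment p U 3) +
        (π2 - 2 * π1) * mixedMoment d 2 1 π1 π2 (θ ^ 2 * moment p U 2) (θ ^ 3 * moment p U 3) +
        (π1 - 2 * π2) * mixedMoment d 1 2 π1 π2 (θ ^ 2 * moment p U 2) (θ ^ 3 * moment p U 3) +
        π2 * mixedMoment d 0 3 π1 π2 (θ ^ 2 * moment p U 2) (θ ^ 3 * moment p U 3) := by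
  rw [← h.prodAvg_eq_mixedMoment d 3 0 (by norm_num),
    ← h.prodAvg_eq_mixedMoment d 2 1 (by norm_num),
    ← h.prodAvg_eq_mixedMoment d 1 2 (by norm_num),
    ← h.prodAvg_eq_mixedMoment d 0 3 (by norm_num), ← prodAvg_const_mul, ← prodAvg_const_mul,
    ← prodAvg_const_mul, ← prodAvg_const_mul, ← prodAvg_add, ← prodAvg_add, ← prodAvg_add]
  congr 1
  funext B
  unfold ratioDiff mixSum
  ring

lemma StepData.prodAvg_mixSum_sub_one_sq (h : StepData π1 π2 θ p U) (d : ℕ) :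
    prodAvg d p (fun B => (mixSum d π1 π2 θ U B - 1) ^ 2) =
      π1 ^ 2 * mixedMoment d 2 0 π1 π2 (θ ^ 2 * moment p U 2) (θ ^ 3 * moment p U 3) +
        2 * (π1 * π2) * mixedMoment d 1 1 π1 π2 (θ ^ 2 * moment p U 2) (θ ^ 3 * moment p U 3) +
        π2 ^ 2 * mixedMoment d 0 2 π1 π2 (θ ^ 2 * moment p U 2) (θ ^ 3 * moment p U 3) - 1 := by
  have h0 : mixedMoment d 0 0 π1 π2 (θ ^ 2 * moment p U 2) (θ ^ 3 * moment p U 3) = 1 := by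
    simp [mixedMoment, mixedCoeff]
  have h1 : mixedMoment d 1 0 π1 π2 (θ ^ 2 * moment p U 2) (θ ^ 3 * moment p U 3) = 1 := by
    simp [mixedMoment, mixedCoeff]
  have h2 : mixedMoment d 0 1 π1 π2 (θ ^ 2 * moment p U 2) (θ ^ 3 * moment p U 3) = 1 := by
    simp [mixedMoment, mixedCoeff]
  have e0 := h.prodAvg_eq_mixedMoment d 0 0 (by norm_num)
  have e1 := h.prodAvg_eq_mixedMoment d 1 0 (by norm_num)
  have e2 := h.prodAvg_eq_mixedMoment d 0 1 (by norm_num)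
  rw [h0] at e0
  rw [h1] at e1
  rw [h2] at e2
  have hexp : prodAvg d p (fun B => (mixSum d π1 π2 θ U B - 1) ^ 2) =
      prodAvg d p (fun B => π1 ^ 2 *
        (affProd d U (θ / π1) B ^ 2 * affProd d U (-(θ / π2)) B ^ 0) +
        2 * (π1 * π2) * (affProd d U (θ / π1) B ^ 1 * affProd d U (-(θ / π2)) B ^ 1) +
        π2 ^ 2 * (affProd d U (θ / π1) B ^ 0 * affProd d U (-(θ / π2)) B ^ 2) -
        2 * π1 * (affProd d U (θ / π1) B ^ 1 * affProd d U (-(θ / π2)) B ^ 0) -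
        2 * π2 * (affProd d U (θ / π1) B ^ 0 * affProd d U (-(θ / π2)) B ^ 1) +
        affProd d U (θ / π1) B ^ 0 * affProd d U (-(θ / π2)) B ^ 0) := by
    congr 1
    funext B
    unfold mixSum
    ring
  rw [hexp]
  simp only [prodAvg_add, prodAvg_sub, prodAvg_const_mul]
  rw [e0, e1, e2, h.prodAvg_eq_mixedMoment d 2 0 (by norm_num),
    h.prodAvg_eq_mixedMoment d 1 1 (by norm_num), h.prodAvg_eq_mixedMoment d 0 2 (by norm_num)]
  linear_combination (-2) * h.sum_pi

lemma StepData.le_nextMoment_two (h : StepData π1 π2 θ p U) (d : ℕ) :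
    (π1 * π2) ^ 2 * (2 * prodAvg d p (fun B => ratioDiff d π1 π2 θ U B ^ 2) -
      prodAvg d p (fun B => ratioDiff d π1 π2 θ U B ^ 2 * mixSum d π1 π2 θ U B)) ≤
      nextMoment d π1 π2 θ p U 2 := by
  rw [← prodAvg_const_mul, ← prodAvg_sub, ← prodAvg_const_mul]
  refine prodAvg_mono h.nonneg fun B => ?_
  rw [h.mul_sq_div]
  refine mul_le_mul_of_nonneg_left ?_ (sq_nonneg _)
  have hS := h.mixSum_pos d B
  rw [le_div_iff₀ hS]
  nlinarith [mul_nonneg (sq_nonneg (ratioDiff d π1 π2 θ U B))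
    (sq_nonneg (mixSum d π1 π2 θ U B - 1))]

lemma StepData.abs_posterior_le_one (h : StepData π1 π2 θ p U) (d : ℕ) (B : Fin d → Ω) :
    |π1 * π2 * ratioDiff d π1 π2 θ U B / mixSum d π1 π2 θ U B| ≤ 1 := by
  have hS := h.mixSum_pos d B
  have a1 := h.affProd1_pos d B
  have a2 := h.affProd2_pos d B
  have h1 := h.pi1_pos
  have h2 := h.pi2_pos
  have h1' : π1 ≤ 1 := by linarith [h.sum_pi]
  have h2' : π2 ≤ 1 := by linarith [h.sum_pi]
  rw [abs_div, abs_of_pos hS, div_le_one hS, abs_le]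
  unfold mixSum ratioDiff
  have e1 := mul_pos h1 a1
  have e2 := mul_pos h2 a2
  constructor
  · nlinarith [mul_le_of_le_one_right e2.le h1', mul_pos h2 e1]
  · nlinarith [mul_le_of_le_one_right e1.le h2', mul_pos h1 e2]

lemma StepData.mixSum_le (h : StepData π1 π2 θ p U) (hθ : |θ| ≤ 1) (d : ℕ)
    (B : Fin d → Ω) :
    mixSum d π1 π2 θ U B ≤ (1 + 1 / π1) ^ d + (1 + 1 / π2) ^ d := by
  have h1 := h.pi1_pos
  have h2 := h.pi2_pos
  have hU : ∀ ω, |θ * U ω| ≤ 1 := fun ω => by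
    rw [abs_mul]
    exact mul_le_one₀ hθ (abs_nonneg _) (h.abs_le_one ω)
  have e1 : affProd d U (θ / π1) B ≤ (1 + 1 / π1) ^ d := by
    refine (Finset.prod_le_prod (fun j _ => (h.fac1_pos (B j)).le) fun j _ => ?_).trans_eq
      (by simp : ∏ _j : Fin d, (1 + 1 / π1) = _)
    have : θ / π1 * U (B j) ≤ 1 / π1 := by
      rw [div_mul_eq_mul_div]
      exact div_le_div_of_nonneg_right (abs_le.1 (hU _)).2 h1.le
    linarith
  have e2 : affProd d U (-(θ / π2)) B ≤ (1 + 1 / π2) ^ d := by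
    refine (Finset.prod_le_prod (fun j _ => (h.fac2_pos (B j)).le) fun j _ => ?_).trans_eq
      (by simp : ∏ _j : Fin d, (1 + 1 / π2) = _)
    have : -(θ / π2) * U (B j) ≤ 1 / π2 := by
      rw [neg_mul, div_mul_eq_mul_div, ← neg_div]
      exact div_le_div_of_nonneg_right (by linarith [(abs_le.1 (hU (B j))).1]) h2.le
    linarith
  have a1 := h.affProd1_pos d B
  have a2 := h.affProd2_pos d B
  have h1' : π1 ≤ 1 := by linarith [h.sum_pi]
  have h2' : π2 ≤ 1 := by linarith [h.sum_pi]
  unfold mixSum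
  nlinarith [mul_le_of_le_one_left a1.le h1', mul_le_of_le_one_left a2.le h2']

lemma StepData.abs_nextMoment_three_sub_le (h : StepData π1 π2 θ p U) (hθ : |θ| ≤ 1) (d : ℕ)
    {ε : ℝ} (hε : 0 < ε) :
    |nextMoment d π1 π2 θ p U 3 -
      (π1 * π2) ^ 3 * prodAvg d p (fun B => ratioDiff d π1 π2 θ U B ^ 3)| ≤
      (1 + (1 + 1 / π1) ^ d + (1 + 1 / π2) ^ d) *
        (ε * prodAvg d p (fun B => ratioDiff d π1 π2 θ U B ^ 2) +
          1 / ε * prodAvg d p (fun B => (mixSum d π1 π2 θ U B - 1) ^ 2)) := by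
  rw [← prodAvg_const_mul, nextMoment, ← prodAvg_sub]
  refine (abs_prodAvg_le h.nonneg _).trans ?_
  rw [← prodAvg_const_mul, ← prodAvg_const_mul, ← prodAvg_add, ← prodAvg_const_mul]
  refine prodAvg_mono h.nonneg fun B => ?_
  have hS := h.mixSum_pos d B
  have hS' := h.mixSum_le hθ d B
  have hX := h.abs_posterior_le_one d B
  have h1 := h.pi1_pos
  have h2 := h.pi2_pos
  have hq : π1 * π2 ≤ 1 := by nlinarith [h.sum_pi]
  have hq0 : 0 < π1 * π2 := mul_pos h1 h2
  set q := π1 * π2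
  set S := mixSum d π1 π2 θ U B
  set D := ratioDiff d π1 π2 θ U B
  set H := (1 + 1 / π1) ^ d + (1 + 1 / π2) ^ d with hH
  have key : S * (q * D / S) ^ 3 - q ^ 3 * D ^ 3 =
      (q * D / S) ^ 2 * (q * (D * (S - 1)) * -(1 + S)) := by
    field_simp
    ring
  have hX2 : |(q * D / S) ^ 2| ≤ 1 := by
    rw [abs_pow]
    exact pow_le_one₀ (abs_nonneg _) hX
  have hDW : |D * (S - 1)| ≤ ε * D ^ 2 + 1 / ε * (S - 1) ^ 2 := by
    have e1 : ε * D ^ 2 + 1 / ε * (S - 1) ^ 2 - D * (S - 1) =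
        ((ε * D - (S - 1) / 2) ^ 2 + 3 / 4 * (S - 1) ^ 2) / ε := by field_simp; ring
    have e2 : ε * D ^ 2 + 1 / ε * (S - 1) ^ 2 + D * (S - 1) =
        ((ε * D + (S - 1) / 2) ^ 2 + 3 / 4 * (S - 1) ^ 2) / ε := by field_simp; ring
    have p1 : 0 ≤ ((ε * D - (S - 1) / 2) ^ 2 + 3 / 4 * (S - 1) ^ 2) / ε := by positivity
    have p2 : 0 ≤ ((ε * D + (S - 1) / 2) ^ 2 + 3 / 4 * (S - 1) ^ 2) / ε := by positivity
    rw [abs_le]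
    constructor <;> linarith
  rw [key, abs_mul, abs_mul, abs_mul, abs_neg, abs_of_pos hq0, abs_of_pos (by linarith : 0 < 1 + S)]
  have hDW0 := abs_nonneg (D * (S - 1))
  calc |(q * D / S) ^ 2| * (q * |D * (S - 1)| * (1 + S))
      ≤ 1 * (1 * |D * (S - 1)| * (1 + H)) := by gcongr
    _ = (1 + H) * |D * (S - 1)| := by ring
    _ ≤ (1 + H) * (ε * D ^ 2 + 1 / ε * (S - 1) ^ 2) :=
        mul_le_mul_of_nonneg_left hDW (by linarith)
    _ = _ := by rw [hH]; ring

end ProductStep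

section Expansion

lemma exists_abs_one_add_pow_sub_le (A : ℝ) (hA : 0 ≤ A) (d : ℕ) :
    ∃ K : ℝ, 0 ≤ K ∧ ∀ a : ℝ, |a| ≤ A →
      |(1 + a) ^ d - (1 + d * a + d * (d - 1) / 2 * a ^ 2)| ≤ K * |a| ^ 3 := by
  induction d with
  | zero => exact ⟨0, le_rfl, fun a _ => by simp⟩
  | succ d ih =>
    obtain ⟨K, hK, h⟩ := ih
    refine ⟨(1 + A) * K + |(d : ℝ) * (d - 1) / 2|, by positivity, fun a ha => ?_⟩
    have e : (1 + a) ^ (d + 1) - (1 + ((d + 1 : ℕ) : ℝ) * a +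
        ((d + 1 : ℕ) : ℝ) * (((d + 1 : ℕ) : ℝ) - 1) / 2 * a ^ 2) =
        (1 + a) * ((1 + a) ^ d - (1 + d * a + d * (d - 1) / 2 * a ^ 2)) +
          (d : ℝ) * (d - 1) / 2 * a ^ 3 := by
      push_cast
      ring
    rw [e]
    refine (abs_add_le _ _).trans ?_
    rw [abs_mul, abs_mul, abs_pow, add_mul, mul_assoc]
    have h1 : |1 + a| ≤ 1 + A := by
      refine (abs_add_le _ _).trans ?_
      rw [abs_one]
      linarith
    have := h a ha
    gcongr

lemma exists_abs_mixedCoeff_le (π1 π2 : ℝ) (a b : ℕ) :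
    ∃ C : ℝ, 0 ≤ C ∧ ∀ s τ : ℝ, |τ| ≤ s → |mixedCoeff a b π1 π2 s τ| ≤ C * s := by
  have linear : ∀ α β : ℝ, ∃ C : ℝ, 0 ≤ C ∧ ∀ s τ : ℝ, |τ| ≤ s → |α * s + β * τ| ≤ C * s := by
    refine fun α β => ⟨|α| + |β|, by positivity, fun s τ hτ => ?_⟩
    refine (abs_add_le _ _).trans ?_
    rw [abs_mul, abs_mul, abs_of_nonneg ((abs_nonneg τ).trans hτ), add_mul]
    gcongr
  exact linear _ _

lemma exists_mixedMoment_expansion (π1 π2 : ℝ) (d a b : ℕ) :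
    ∃ K : ℝ, 0 ≤ K ∧ ∀ s τ : ℝ, |τ| ≤ s → s ≤ 1 →
      |mixedMoment d a b π1 π2 s τ - (1 + d * mixedCoeff a b π1 π2 s τ +
        d * (d - 1) / 2 * mixedCoeff a b π1 π2 s τ ^ 2)| ≤ K * s ^ 3 := by
  obtain ⟨C, hC, hL⟩ := exists_abs_mixedCoeff_le π1 π2 a b
  obtain ⟨K, hK, h⟩ := exists_abs_one_add_pow_sub_le C hC d
  refine ⟨K * C ^ 3, by positivity, fun s τ hτ hs => ?_⟩
  have hs0 : 0 ≤ s := (abs_nonneg τ).trans hτ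
  have hL := hL s τ hτ
  refine (h _ (hL.trans (mul_le_of_le_one_right (by positivity) hs))).trans ?_
  rw [mul_assoc, ← mul_pow]
  gcongr

lemma exists_mixedMoment_linear_expansion (π1 π2 : ℝ) (d a b : ℕ) :
    ∃ K : ℝ, 0 ≤ K ∧ ∀ s τ : ℝ, |τ| ≤ s → s ≤ 1 →
      |mixedMoment d a b π1 π2 s τ - (1 + d * mixedCoeff a b π1 π2 s τ)| ≤ K * s ^ 2 := by
  obtain ⟨K, hK, h⟩ := exists_mixedMoment_expansion π1 π2 d a b
  obtain ⟨C, hC, hL⟩ := exists_abs_mixedCoeff_le π1 π2 a b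
  refine ⟨K + |(d : ℝ) * (d - 1) / 2| * C ^ 2, by positivity, fun s τ hτ hs => ?_⟩
  have hs0 : 0 ≤ s := (abs_nonneg τ).trans hτ
  have hL := hL s τ hτ
  have h1 := h s τ hτ hs
  have h2 : |(d : ℝ) * (d - 1) / 2 * mixedCoeff a b π1 π2 s τ ^ 2| ≤
      |(d : ℝ) * (d - 1) / 2| * C ^ 2 * s ^ 2 := by
    rw [abs_mul, abs_pow, mul_assoc, ← mul_pow]
    gcongr
  have h3 : K * s ^ 3 ≤ K * s ^ 2 :=
    mul_le_mul_of_nonneg_left (pow_le_pow_of_le_one hs0 hs (by norm_num)) hK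
  have e : mixedMoment d a b π1 π2 s τ - (1 + d * mixedCoeff a b π1 π2 s τ) =
      (mixedMoment d a b π1 π2 s τ - (1 + d * mixedCoeff a b π1 π2 s τ +
        d * (d - 1) / 2 * mixedCoeff a b π1 π2 s τ ^ 2)) +
        d * (d - 1) / 2 * mixedCoeff a b π1 π2 s τ ^ 2 := by ring
  rw [e]
  refine (abs_add_le _ _).trans ?_
  linarith

/-- `E (Z₁ - Z₂)²`. -/
noncomputable def diffSq (d : ℕ) (π1 π2 s τ : ℝ) : ℝ :=
  mixedMoment d 2 0 π1 π2 s τ - 2 * mixedMoment d 1 1 π1 π2 s τ + mixedMoment d 0 2 π1 π2 s τ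

/-- `E (Z₁ - Z₂)³`. -/
noncomputable def diffCube (d : ℕ) (π1 π2 s τ : ℝ) : ℝ :=
  mixedMoment d 3 0 π1 π2 s τ - 3 * mixedMoment d 2 1 π1 π2 s τ +
    3 * mixedMoment d 1 2 π1 π2 s τ - mixedMoment d 0 3 π1 π2 s τ

/-- `E (Z₁ - Z₂)² (π₁ Z₁ + π₂ Z₂)`. -/
noncomputable def diffSqMix (d : ℕ) (π1 π2 s τ : ℝ) : ℝ :=
  π1 * mixedMoment d 3 0 π1 π2 s τ + (π2 - 2 * π1) * mixedMoment d 2 1 π1 π2 s τ +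
    (π1 - 2 * π2) * mixedMoment d 1 2 π1 π2 s τ + π2 * mixedMoment d 0 3 π1 π2 s τ

/-- `E (π₁ Z₁ + π₂ Z₂ - 1)²`. -/
noncomputable def mixVar (d : ℕ) (π1 π2 s τ : ℝ) : ℝ :=
  π1 ^ 2 * mixedMoment d 2 0 π1 π2 s τ + 2 * (π1 * π2) * mixedMoment d 1 1 π1 π2 s τ +
    π2 ^ 2 * mixedMoment d 0 2 π1 π2 s τ - 1

variable {π1 π2 : ℝ}

lemma exists_mixVar_le (hsum : π1 + π2 = 1) (h1 : 0 < π1) (h2 : 0 < π2) (d : ℕ) :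
    ∃ K : ℝ, 0 ≤ K ∧ ∀ s τ : ℝ, |τ| ≤ s → s ≤ 1 → mixVar d π1 π2 s τ ≤ K * s ^ 2 := by
  obtain ⟨K1, hK1, e1⟩ := exists_mixedMoment_linear_expansion π1 π2 d 2 0
  obtain ⟨K2, hK2, e2⟩ := exists_mixedMoment_linear_expansion π1 π2 d 1 1
  obtain ⟨K3, hK3, e3⟩ := exists_mixedMoment_linear_expansion π1 π2 d 0 2
  refine ⟨π1 ^ 2 * K1 + 2 * (π1 * π2) * K2 + π2 ^ 2 * K3, by positivity, fun s τ hτ hs => ?_⟩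
  have b1 := mul_le_mul_of_nonneg_left (abs_le.1 (e1 s τ hτ hs)).2 (sq_nonneg π1)
  have b2 := mul_le_mul_of_nonneg_left (abs_le.1 (e2 s τ hτ hs)).2
    (by positivity : 0 ≤ 2 * (π1 * π2))
  have b3 := mul_le_mul_of_nonneg_left (abs_le.1 (e3 s τ hτ hs)).2 (sq_nonneg π2)
  have hid : π1 ^ 2 * (1 + d * mixedCoeff 2 0 π1 π2 s τ) +
      2 * (π1 * π2) * (1 + d * mixedCoeff 1 1 π1 π2 s τ) +
      π2 ^ 2 * (1 + d * mixedCoeff 0 2 π1 π2 s τ) = 1 := by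
    obtain rfl : π2 = 1 - π1 := by linarith
    simp only [mixedCoeff]
    push_cast
    field_simp
    ring
  unfold mixVar
  linarith

lemma exists_diffSq_le (hsum : π1 + π2 = 1) (h1 : 0 < π1) (h2 : 0 < π2) (d : ℕ) :
    ∃ K : ℝ, 0 ≤ K ∧ ∀ s τ : ℝ, |τ| ≤ s → s ≤ 1 → diffSq d π1 π2 s τ ≤ K * s := by
  obtain ⟨K1, hK1, e1⟩ := exists_mixedMoment_linear_expansion π1 π2 d 2 0
  obtain ⟨K2, hK2, e2⟩ := exists_mixedMoment_linear_expansion π1 π2 d 1 1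
  obtain ⟨K3, hK3, e3⟩ := exists_mixedMoment_linear_expansion π1 π2 d 0 2
  refine ⟨d / (π1 * π2) ^ 2 + (K1 + 2 * K2 + K3), by positivity, fun s τ hτ hs => ?_⟩
  have hs0 : 0 ≤ s := (abs_nonneg τ).trans hτ
  have b1 := (abs_le.1 (e1 s τ hτ hs)).2
  have b2 := (abs_le.1 (e2 s τ hτ hs)).1
  have b3 := (abs_le.1 (e3 s τ hτ hs)).2
  have hid : (1 + d * mixedCoeff 2 0 π1 π2 s τ) - 2 * (1 + d * mixedCoeff 1 1 π1 π2 s τ) +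
      (1 + d * mixedCoeff 0 2 π1 π2 s τ) = d / (π1 * π2) ^ 2 * s := by
    obtain rfl : π2 = 1 - π1 := by linarith
    simp only [mixedCoeff]
    push_cast
    field_simp
    ring
  have hsq : (K1 + 2 * K2 + K3) * s ^ 2 ≤ (K1 + 2 * K2 + K3) * s := by
    refine mul_le_mul_of_nonneg_left ?_ (by positivity)
    nlinarith
  unfold diffSq
  linarith

lemma exists_abs_diffCube_sub_le (hsum : π1 + π2 = 1) (h1 : 0 < π1) (h2 : 0 < π2) (d : ℕ) :
    ∃ K : ℝ, 0 ≤ K ∧ ∀ s τ : ℝ, |τ| ≤ s → s ≤ 1 →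
      |(π1 * π2) ^ 3 * diffCube d π1 π2 s τ - d * τ| ≤ K * s ^ 2 := by
  obtain ⟨K1, hK1, e1⟩ := exists_mixedMoment_linear_expansion π1 π2 d 3 0
  obtain ⟨K2, hK2, e2⟩ := exists_mixedMoment_linear_expansion π1 π2 d 2 1
  obtain ⟨K3, hK3, e3⟩ := exists_mixedMoment_linear_expansion π1 π2 d 1 2
  obtain ⟨K4, hK4, e4⟩ := exists_mixedMoment_linear_expansion π1 π2 d 0 3
  refine ⟨(π1 * π2) ^ 3 * (K1 + 3 * K2 + 3 * K3 + K4), by positivity, fun s τ hτ hs => ?_⟩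
  have b1 := abs_le.1 (e1 s τ hτ hs)
  have b2 := abs_le.1 (e2 s τ hτ hs)
  have b3 := abs_le.1 (e3 s τ hτ hs)
  have b4 := abs_le.1 (e4 s τ hτ hs)
  have hid : (π1 * π2) ^ 3 * ((1 + d * mixedCoeff 3 0 π1 π2 s τ) -
      3 * (1 + d * mixedCoeff 2 1 π1 π2 s τ) + 3 * (1 + d * mixedCoeff 1 2 π1 π2 s τ) -
      (1 + d * mixedCoeff 0 3 π1 π2 s τ)) = d * τ := by
    obtain rfl : π2 = 1 - π1 := by linarith
    simp only [mixedCoeff]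
    push_cast
    field_simp
    ring
  rw [← hid, ← mul_sub, abs_mul, abs_of_pos (by positivity : 0 < (π1 * π2) ^ 3), mul_assoc]
  refine mul_le_mul_of_nonneg_left ?_ (by positivity)
  unfold diffCube
  rw [abs_le]
  constructor <;> linarith [b1.1, b1.2, b2.1, b2.2, b3.1, b3.2, b4.1, b4.2]

/-- The lower bound for the next variance coming from `1 / S ≥ 2 - S`. -/
noncomputable def varLower (d : ℕ) (π1 π2 s τ : ℝ) : ℝ :=
  (π1 * π2) ^ 2 * (2 * diffSq d π1 π2 s τ - diffSqMix d π1 π2 s τ)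

lemma exists_le_varLower (hsum : π1 + π2 = 1) (h1 : 0 < π1) (h2 : 0 < π2) :
    ∃ C : ℝ, 0 ≤ C ∧ ∀ d : ℕ, ∃ K : ℝ, 0 ≤ K ∧ ∀ s τ : ℝ, |τ| ≤ s → s ≤ 1 →
      d * s + d * (d - 1) / 2 *
        ((1 - 6 * π1 * π2) / (π1 * π2) ^ 2 * s ^ 2 - C * (s * |τ|)) - K * s ^ 3 ≤
        varLower d π1 π2 s τ := by
  set C1 : ℝ := -(π1 * π2) ^ 2 * (π1 * (6 / π1 ^ 5) +
    (π2 - 2 * π1) * (-2 * (1 / π1 ^ 2 - 2 / (π1 * π2)) / (π1 ^ 2 * π2)) +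
    (π1 - 2 * π2) * (2 * (1 / π2 ^ 2 - 2 / (π1 * π2)) / (π1 * π2 ^ 2)) -
    π2 * (6 / π2 ^ 5)) with hC1
  set C2 : ℝ := -(π1 * π2) ^ 2 * (π1 / π1 ^ 6 + (π2 - 2 * π1) / (π1 ^ 4 * π2 ^ 2) +
    (π1 - 2 * π2) / (π1 ^ 2 * π2 ^ 4) + π2 / π2 ^ 6) with hC2
  refine ⟨|C1| + |C2|, by positivity, fun d => ?_⟩
  obtain ⟨K1, hK1, e1⟩ := exists_mixedMoment_expansion π1 π2 d 2 0
  obtain ⟨K2, hK2, e2⟩ := exists_mixedMoment_expansion π1 π2 d 1 1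
  obtain ⟨K3, hK3, e3⟩ := exists_mixedMoment_expansion π1 π2 d 0 2
  obtain ⟨K4, hK4, e4⟩ := exists_mixedMoment_expansion π1 π2 d 3 0
  obtain ⟨K5, hK5, e5⟩ := exists_mixedMoment_expansion π1 π2 d 2 1
  obtain ⟨K6, hK6, e6⟩ := exists_mixedMoment_expansion π1 π2 d 1 2
  obtain ⟨K7, hK7, e7⟩ := exists_mixedMoment_expansion π1 π2 d 0 3
  refine ⟨(π1 * π2) ^ 2 * (2 * K1 + 4 * K2 + 2 * K3 + π1 * K4 + |π2 - 2 * π1| * K5 +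
    |π1 - 2 * π2| * K6 + π2 * K7), by positivity, fun s τ hτ hs => ?_⟩
  have hs0 : 0 ≤ s := (abs_nonneg τ).trans hτ
  set P : ℕ → ℕ → ℝ := fun a b => 1 + d * mixedCoeff a b π1 π2 s τ +
    d * (d - 1) / 2 * mixedCoeff a b π1 π2 s τ ^ 2 with hP
  have hid : (π1 * π2) ^ 2 * (2 * (P 2 0 - 2 * P 1 1 + P 0 2) -
      (π1 * P 3 0 + (π2 - 2 * π1) * P 2 1 + (π1 - 2 * π2) * P 1 2 + π2 * P 0 3)) =
      d * s + d * (d - 1) / 2 * ((1 - 6 * π1 * π2) / (π1 * π2) ^ 2 * s ^ 2 +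
        (C1 * (s * τ) + C2 * τ ^ 2)) := by
    rw [hC1, hC2, hP]
    obtain rfl : π2 = 1 - π1 := by linarith
    simp only [mixedCoeff]
    push_cast
    field_simp
    ring
  have hd : (0 : ℝ) ≤ d * (d - 1) / 2 := by
    rcases d with _ | d
    · simp
    · push_cast
      have : (0 : ℝ) ≤ d := d.cast_nonneg
      nlinarith
  have hcross : -((|C1| + |C2|) * (s * |τ|)) ≤ C1 * (s * τ) + C2 * τ ^ 2 := by
    have a1 : |C1 * (s * τ)| = |C1| * (s * |τ|) := by rw [abs_mul C1, abs_mul s, abs_of_nonneg hs0]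
    have a2 : |C2 * τ ^ 2| ≤ |C2| * (s * |τ|) := by
      rw [abs_mul C2, abs_pow, sq]
      gcongr
    linarith [neg_abs_le (C1 * (s * τ)), neg_abs_le (C2 * τ ^ 2)]
  have hcross' := mul_le_mul_of_nonneg_left hcross hd
  have b1 := (abs_le.1 (e1 s τ hτ hs)).1
  have b2 := (abs_le.1 (e2 s τ hτ hs)).2
  have b3 := (abs_le.1 (e3 s τ hτ hs)).1
  have b4 := mul_le_mul_of_nonneg_left (abs_le.1 (e4 s τ hτ hs)).2 h1.le
  have mulabs : ∀ c r K : ℝ, |r| ≤ K * s ^ 3 → c * r ≤ |c| * K * s ^ 3 := fun c r K hr => by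
    refine (le_abs_self _).trans ?_
    rw [abs_mul, mul_assoc]
    gcongr
  have b5 := mulabs (π2 - 2 * π1) _ K5 (e5 s τ hτ hs)
  have b6 := mulabs (π1 - 2 * π2) _ K6 (e6 s τ hτ hs)
  have b7 := mul_le_mul_of_nonneg_left (abs_le.1 (e7 s τ hτ hs)).2 h2.le
  have hrem : 2 * (P 2 0 - 2 * P 1 1 + P 0 2) -
      (π1 * P 3 0 + (π2 - 2 * π1) * P 2 1 + (π1 - 2 * π2) * P 1 2 + π2 * P 0 3) -
      (2 * K1 + 4 * K2 + 2 * K3 + π1 * K4 + |π2 - 2 * π1| * K5 +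
        |π1 - 2 * π2| * K6 + π2 * K7) * s ^ 3 ≤
      2 * diffSq d π1 π2 s τ - diffSqMix d π1 π2 s τ := by
    unfold diffSq diffSqMix
    simp only [hP]
    linarith
  have hmul := mul_le_mul_of_nonneg_left hrem (sq_nonneg (π1 * π2))
  rw [mul_sub, hid] at hmul
  unfold varLower
  linarith

end Expansion

section TreeStep

/-- The centered posterior probability that the root has the first state. -/
noncomputable def centeredPost (d : ℕ) (θ Δ : ℝ) (n : ℕ) (A : LConf d n) : ℝ :=
  post d θ Δ n 0 A - pst θ Δ 0

variable {π1 π2 θ : ℝ}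

lemma pst_Dlt (hsum : π1 + π2 = 1) (hθ : θ ≠ 1) :
    pst θ (Dlt θ π1 π2) 0 = π1 ∧ pst θ (Dlt θ π1 π2) 1 = π2 := by
  have h : 1 - θ ≠ 0 := sub_ne_zero.2 hθ.symm
  obtain rfl : π2 = 1 - π1 := by linarith
  constructor <;> simp only [pst, Dlt] <;> norm_num <;> field_simp <;> ring

lemma Mmat_Dlt (hsum : π1 + π2 = 1) :
    Mmat θ (Dlt θ π1 π2) 0 0 = π1 + θ * π2 ∧ Mmat θ (Dlt θ π1 π2) 0 1 = π2 - θ * π2 ∧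
      Mmat θ (Dlt θ π1 π2) 1 0 = π1 - θ * π1 ∧ Mmat θ (Dlt θ π1 π2) 1 1 = π2 + θ * π1 := by
  obtain rfl : π2 = 1 - π1 := by linarith
  refine ⟨?_, ?_, ?_, ?_⟩ <;> simp only [Mmat, Dlt] <;> norm_num <;> ring

lemma levelProb_pos (hsum : π1 + π2 = 1) (h1 : 0 < π1) (h2 : 0 < π2) (hθ : θ ≠ 1)
    (hM : ∀ i j, 0 < Mmat θ (Dlt θ π1 π2) i j) (d n : ℕ)
    (A : LConf d n) : 0 < levelProb d θ (Dlt θ π1 π2) n A := by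
  obtain ⟨e1, e2⟩ := pst_Dlt (π1 := π1) hsum hθ
  obtain ⟨hL, hL'⟩ := lik_nonneg_and_pos hM n A
  rw [levelProb_eq, e1, e2]
  rcases (hL 0).eq_or_lt with h0 | h0
  · exact add_pos_of_nonneg_of_pos (mul_nonneg h1.le (hL 0)) (mul_pos h2 (by linarith))
  · exact add_pos_of_pos_of_nonneg (mul_pos h1 h0) (mul_nonneg h2.le (hL 1))

lemma centeredPost_eq (hsum : π1 + π2 = 1) (h1 : 0 < π1) (h2 : 0 < π2) (hθ : θ ≠ 1)
    (hM : ∀ i j, 0 < Mmat θ (Dlt θ π1 π2) i j) (d n : ℕ)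
    (A : LConf d n) :
    centeredPost d θ (Dlt θ π1 π2) n A =
      π1 * π2 * (lik d θ (Dlt θ π1 π2) n 0 A - lik d θ (Dlt θ π1 π2) n 1 A) /
        levelProb d θ (Dlt θ π1 π2) n A := by
  have hp := levelProb_pos hsum h1 h2 hθ hM d n A
  obtain ⟨e1, e2⟩ := pst_Dlt (π1 := π1) hsum hθ
  rw [centeredPost, post, jointProb_eq, eq_div_iff hp.ne', sub_mul, div_mul_cancel₀ _ hp.ne',
    levelProb_eq, e1, e2]
  linear_combination (-π1 * lik d θ (Dlt θ π1 π2) n 0 A) * hsum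

lemma levelProb_mul_fac1 (hsum : π1 + π2 = 1) (h1 : 0 < π1) (h2 : 0 < π2) (hθ : θ ≠ 1)
    (hM : ∀ i j, 0 < Mmat θ (Dlt θ π1 π2) i j) (d n : ℕ)
    (A : LConf d n) :
    levelProb d θ (Dlt θ π1 π2) n A * (1 + θ / π1 * centeredPost d θ (Dlt θ π1 π2) n A) =
      ∑ k, Mmat θ (Dlt θ π1 π2) 0 k * lik d θ (Dlt θ π1 π2) n k A := by
  have hp := (levelProb_pos hsum h1 h2 hθ hM d n A).ne'
  obtain ⟨e1, e2⟩ := pst_Dlt (π1 := π1) hsum hθ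
  obtain ⟨m1, m2, -, -⟩ := Mmat_Dlt (θ := θ) hsum
  rw [centeredPost_eq hsum h1 h2 hθ hM, Fin.sum_univ_two, m1, m2]
  field_simp
  rw [levelProb_eq, e1, e2]
  ring

lemma levelProb_mul_fac2 (hsum : π1 + π2 = 1) (h1 : 0 < π1) (h2 : 0 < π2) (hθ : θ ≠ 1)
    (hM : ∀ i j, 0 < Mmat θ (Dlt θ π1 π2) i j) (d n : ℕ)
    (A : LConf d n) :
    levelProb d θ (Dlt θ π1 π2) n A * (1 + -(θ / π2) * centeredPost d θ (Dlt θ π1 π2) n A) =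
      ∑ k, Mmat θ (Dlt θ π1 π2) 1 k * lik d θ (Dlt θ π1 π2) n k A := by
  have hp := (levelProb_pos hsum h1 h2 hθ hM d n A).ne'
  obtain ⟨e1, e2⟩ := pst_Dlt (π1 := π1) hsum hθ
  obtain ⟨-, -, m1, m2⟩ := Mmat_Dlt (θ := θ) hsum
  rw [centeredPost_eq hsum h1 h2 hθ hM, Fin.sum_univ_two, m1, m2]
  field_simp
  rw [levelProb_eq, e1, e2]
  ring

lemma stepData_level (hsum : π1 + π2 = 1) (h1 : 0 < π1) (h2 : 0 < π2) (hθ : θ ≠ 1)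
    (hM : ∀ i j, 0 < Mmat θ (Dlt θ π1 π2) i j) (d n : ℕ) :
    StepData π1 π2 θ (levelProb d θ (Dlt θ π1 π2) n) (centeredPost d θ (Dlt θ π1 π2) n) := by
  obtain ⟨e1, e2⟩ := pst_Dlt (π1 := π1) hsum hθ
  have hp := levelProb_pos hsum h1 h2 hθ hM d n
  refine ⟨⟨fun A => (hp A).le, ?_, ?_, fun A => ?_⟩, hsum, h1, h2, fun A => ?_, fun A => ?_⟩
  · simp only [levelProb_eq, Finset.sum_add_distrib, ← Finset.mul_sum, sum_lik, e1, e2]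
    linarith
  · have : ∀ A, levelProb d θ (Dlt θ π1 π2) n A * centeredPost d θ (Dlt θ π1 π2) n A =
        π1 * π2 * (lik d θ (Dlt θ π1 π2) n 0 A - lik d θ (Dlt θ π1 π2) n 1 A) := fun A => by
      rw [centeredPost_eq hsum h1 h2 hθ hM, mul_div_cancel₀ _ (hp A).ne']
    simp only [this, ← Finset.mul_sum, Finset.sum_sub_distrib, sum_lik]
    ring
  · obtain ⟨hL, -⟩ := lik_nonneg_and_pos hM n A
    rw [centeredPost_eq hsum h1 h2 hθ hM, abs_div, abs_of_pos (hp A), div_le_one (hp A),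
      levelProb_eq, e1, e2, abs_le]
    have a0 := mul_nonneg h1.le (hL 0)
    have a1 := mul_nonneg h2.le (hL 1)
    constructor
    · nlinarith [mul_le_of_le_one_left a1 (by linarith : π1 ≤ 1), mul_nonneg h2.le a0]
    · nlinarith [mul_le_of_le_one_left a0 (by linarith : π2 ≤ 1), mul_nonneg h1.le a1]
  · refine pos_of_mul_pos_right ?_ (hp A).le
    rw [levelProb_mul_fac1 hsum h1 h2 hθ hM]
    exact sum_Mmat_mul_lik_pos hM n 0 A
  · refine pos_of_mul_pos_right ?_ (hp A).le
    rw [levelProb_mul_fac2 hsum h1 h2 hθ hM]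
    exact sum_Mmat_mul_lik_pos hM n 1 A

lemma moment_level_succ (hsum : π1 + π2 = 1) (h1 : 0 < π1) (h2 : 0 < π2) (hθ : θ ≠ 1)
    (hM : ∀ i j, 0 < Mmat θ (Dlt θ π1 π2) i j) (d n : ℕ)
    (k : ℕ) :
    moment (levelProb d θ (Dlt θ π1 π2) (n + 1)) (centeredPost d θ (Dlt θ π1 π2) (n + 1)) k =
      nextMoment d π1 π2 θ (levelProb d θ (Dlt θ π1 π2) n)
        (centeredPost d θ (Dlt θ π1 π2) n) k := by
  obtain ⟨e1, e2⟩ := pst_Dlt (π1 := π1) hsum hθ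
  have hp := levelProb_pos hsum h1 h2 hθ hM d n
  rw [nextMoment, prodAvg, moment, ← (levelEquiv d n).sum_comp]
  refine Finset.sum_congr rfl fun A _ => ?_
  set B := levelEquiv d n A with hB
  have hQ : 0 < ∏ j, levelProb d θ (Dlt θ π1 π2) n (B j) := Finset.prod_pos fun j _ => hp _
  have l0 : lik d θ (Dlt θ π1 π2) (n + 1) 0 A = (∏ j, levelProb d θ (Dlt θ π1 π2) n (B j)) *
      affProd d (centeredPost d θ (Dlt θ π1 π2) n) (θ / π1) B := by
    rw [lik_succ, affProd, ← Finset.prod_mul_distrib]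
    exact Finset.prod_congr rfl fun j _ => (levelProb_mul_fac1 hsum h1 h2 hθ hM d n _).symm
  have l1 : lik d θ (Dlt θ π1 π2) (n + 1) 1 A = (∏ j, levelProb d θ (Dlt θ π1 π2) n (B j)) *
      affProd d (centeredPost d θ (Dlt θ π1 π2) n) (-(θ / π2)) B := by
    rw [lik_succ, affProd, ← Finset.prod_mul_distrib]
    exact Finset.prod_congr rfl fun j _ => (levelProb_mul_fac2 hsum h1 h2 hθ hM d n _).symm
  have lp : levelProb d θ (Dlt θ π1 π2) (n + 1) A =
      (∏ j, levelProb d θ (Dlt θ π1 π2) n (B j)) *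
        mixSum d π1 π2 θ (centeredPost d θ (Dlt θ π1 π2) n) B := by
    rw [levelProb_eq, e1, e2, l0, l1, mixSum]
    ring
  have lU : centeredPost d θ (Dlt θ π1 π2) (n + 1) A =
      π1 * π2 * ratioDiff d π1 π2 θ (centeredPost d θ (Dlt θ π1 π2) n) B /
        mixSum d π1 π2 θ (centeredPost d θ (Dlt θ π1 π2) n) B := by
    rw [centeredPost_eq hsum h1 h2 hθ hM, lp, l0, l1, ← mul_sub, mul_left_comm,
      mul_div_mul_left _ _ hQ.ne']
    rfl
  rw [lp, lU, mul_assoc]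

lemma xseq_eq_moment_div (hsum : π1 + π2 = 1) (h1 : 0 < π1) (h2 : 0 < π2) (hθ : θ ≠ 1)
    (hM : ∀ i j, 0 < Mmat θ (Dlt θ π1 π2) i j) (d n : ℕ) :
    xseq d θ (Dlt θ π1 π2) n =
      moment (levelProb d θ (Dlt θ π1 π2) n) (centeredPost d θ (Dlt θ π1 π2) n) 2 / π1 := by
  obtain ⟨e1, e2⟩ := pst_Dlt (π1 := π1) hsum hθ
  have hp := levelProb_pos hsum h1 h2 hθ hM d n
  have hD := stepData_level hsum h1 h2 hθ hM d n
  have key : ∀ A, condLevel d θ (Dlt θ π1 π2) n 0 A = levelProb d θ (Dlt θ π1 π2) n A *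
      (1 + centeredPost d θ (Dlt θ π1 π2) n A / π1) := fun A => by
    have hpA := (hp A).ne'
    rw [condLevel, centeredPost, post, e1]
    field_simp
    ring
  have h3 : ∑ A, levelProb d θ (Dlt θ π1 π2) n A * (π1 * (1 +
      2 / π1 * centeredPost d θ (Dlt θ π1 π2) n A +
      1 / π1 ^ 2 * centeredPost d θ (Dlt θ π1 π2) n A ^ 2 +
      0 * centeredPost d θ (Dlt θ π1 π2) n A ^ 3)) =
      π1 * (1 + (1 / π1 ^ 2 *
        moment (levelProb d θ (Dlt θ π1 π2) n) (centeredPost d θ (Dlt θ π1 π2) n) 2 +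
        0 * moment (levelProb d θ (Dlt θ π1 π2) n) (centeredPost d θ (Dlt θ π1 π2) n) 3)) := by
    rw [← hD.sum_mul_eq (2 / π1) (1 / π1 ^ 2) 0 _ fun A => rfl, Finset.mul_sum]
    exact Finset.sum_congr rfl fun A _ => by ring
  have h4 : expect1 d θ (Dlt θ π1 π2) n (fun A => post d θ (Dlt θ π1 π2) n 0 A) =
      ∑ A, levelProb d θ (Dlt θ π1 π2) n A * (π1 * (1 +
      2 / π1 * centeredPost d θ (Dlt θ π1 π2) n A +
      1 / π1 ^ 2 * centeredPost d θ (Dlt θ π1 π2) n A ^ 2 +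
      0 * centeredPost d θ (Dlt θ π1 π2) n A ^ 3)) := by
    refine Finset.sum_congr rfl fun A _ => ?_
    have : post d θ (Dlt θ π1 π2) n 0 A = π1 + centeredPost d θ (Dlt θ π1 π2) n A := by
      rw [centeredPost, e1]; ring
    dsimp only
    rw [key, this]
    field_simp
    ring
  rw [xseq, h4, h3, e1]
  field_simp
  ring

end TreeStep

section Recursion

lemma StepData.moment_two_nonneg {Ω : Type} [Fintype Ω] {π1 π2 θ : ℝ} {p U : Ω → ℝ}
    (h : StepData π1 π2 θ p U) : 0 ≤ moment p U 2 :=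
  Finset.sum_nonneg fun ω _ => mul_nonneg (h.nonneg ω) (sq_nonneg _)

lemma StepData.abs_moment_three_le {Ω : Type} [Fintype Ω] {π1 π2 θ : ℝ} {p U : Ω → ℝ}
    (h : StepData π1 π2 θ p U) : |moment p U 3| ≤ moment p U 2 := by
  refine (Finset.abs_sum_le_sum_abs _ _).trans (Finset.sum_le_sum fun ω _ => ?_)
  rw [abs_mul, abs_of_nonneg (h.nonneg ω), abs_pow, ← sq_abs (U ω)]
  exact mul_le_mul_of_nonneg_left
    (pow_le_pow_of_le_one (abs_nonneg _) (h.abs_le_one ω) (by norm_num)) (h.nonneg ω)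

lemma StepData.moment_two_le_one {Ω : Type} [Fintype Ω] {π1 π2 θ : ℝ} {p U : Ω → ℝ}
    (h : StepData π1 π2 θ p U) : moment p U 2 ≤ 1 := by
  rw [← h.sum_eq_one]
  refine Finset.sum_le_sum fun ω _ => mul_le_of_le_one_right (h.nonneg ω) ?_
  rw [← sq_abs]
  exact pow_le_one₀ (abs_nonneg _) (h.abs_le_one ω)

lemma StepData.scaled_moment_bounds {Ω : Type} [Fintype Ω] {π1 π2 θ : ℝ} {p U : Ω → ℝ}
    (h : StepData π1 π2 θ p U) (hθ : |θ| ≤ 1) {r : ℝ}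
    (hr : |moment p U 3| ≤ r * moment p U 2) :
    |θ ^ 3 * moment p U 3| ≤ r * (θ ^ 2 * moment p U 2) ∧
      θ ^ 2 * moment p U 2 ≤ moment p U 2 := by
  have hθ2 : θ ^ 2 ≤ 1 := (sq_le_one_iff_abs_le_one θ).2 hθ
  constructor
  · rw [abs_mul, abs_pow]
    calc |θ| ^ 3 * |moment p U 3| ≤ |θ| ^ 2 * |moment p U 3| :=
          mul_le_mul_of_nonneg_right (pow_le_pow_of_le_one (abs_nonneg _) hθ (by norm_num))
            (abs_nonneg _)
      _ ≤ |θ| ^ 2 * (r * moment p U 2) := mul_le_mul_of_nonneg_left hr (by positivity)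
      _ = _ := by rw [sq_abs]; ring
  · exact mul_le_of_le_one_left h.moment_two_nonneg hθ2

lemma StepData.varLower_le_nextMoment {Ω : Type} [Fintype Ω] {π1 π2 θ : ℝ} {p U : Ω → ℝ}
    (h : StepData π1 π2 θ p U) (d : ℕ) :
    varLower d π1 π2 (θ ^ 2 * moment p U 2) (θ ^ 3 * moment p U 3) ≤
      nextMoment d π1 π2 θ p U 2 := by
  have := h.le_nextMoment_two d
  rwa [h.prodAvg_ratioDiff_sq, h.prodAvg_ratioDiff_sq_mul_mixSum] at this

variable {π1 π2 : ℝ}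

lemma exists_linear_le_nextMoment_two (hsum : π1 + π2 = 1) (h1 : 0 < π1) (h2 : 0 < π2) (d : ℕ) :
    ∃ K : ℝ, 0 ≤ K ∧ ∀ {Ω : Type} [Fintype Ω] (θ : ℝ) (p U : Ω → ℝ),
      StepData π1 π2 θ p U → |θ| ≤ 1 →
        d * θ ^ 2 * moment p U 2 - K * moment p U 2 ^ 2 ≤ nextMoment d π1 π2 θ p U 2 := by
  obtain ⟨C, hC, hd⟩ := exists_le_varLower hsum h1 h2
  obtain ⟨K, hK, hle⟩ := hd d
  refine ⟨|(d : ℝ) * (d - 1) / 2| * (|(1 - 6 * π1 * π2) / (π1 * π2) ^ 2| + C) + K,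
    by positivity, fun {Ω} _ θ p U h hθ => ?_⟩
  obtain ⟨b1, b2⟩ := h.scaled_moment_bounds hθ (r := 1) (by simpa using h.abs_moment_three_le)
  rw [one_mul] at b1
  have hv0 := h.moment_two_nonneg
  have hv1 := h.moment_two_le_one
  refine le_trans ?_ ((hle _ _ b1 (b2.trans hv1)).trans (h.varLower_le_nextMoment d))
  set v := moment p U 2
  set s := θ ^ 2 * v with hs
  set τ := θ ^ 3 * moment p U 3
  have hs0 : 0 ≤ s := by positivity
  have hsv : s ^ 2 ≤ v ^ 2 := pow_le_pow_left₀ hs0 b2 2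
  have hcube : K * s ^ 3 ≤ K * v ^ 2 := mul_le_mul_of_nonneg_left
    ((pow_le_pow_of_le_one hs0 (b2.trans hv1) (by norm_num)).trans hsv) hK
  set c := (1 - 6 * π1 * π2) / (π1 * π2) ^ 2
  have hquad : |c * s ^ 2 - C * (s * |τ|)| ≤ (|c| + C) * v ^ 2 := by
    refine (abs_sub _ _).trans ?_
    rw [abs_mul, abs_mul, abs_of_nonneg hC, abs_of_nonneg (sq_nonneg s),
      abs_of_nonneg (mul_nonneg hs0 (abs_nonneg τ)), add_mul]
    have : s * |τ| ≤ v ^ 2 := by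
      calc s * |τ| ≤ s * s := mul_le_mul_of_nonneg_left b1 hs0
        _ ≤ v ^ 2 := by rw [← sq]; exact hsv
    gcongr
  have hprod : |(d : ℝ) * (d - 1) / 2 * (c * s ^ 2 - C * (s * |τ|))| ≤
      |(d : ℝ) * (d - 1) / 2| * (|c| + C) * v ^ 2 := by
    rw [abs_mul, mul_assoc (|(d : ℝ) * (d - 1) / 2|)]
    exact mul_le_mul_of_nonneg_left hquad (abs_nonneg _)
  have := (abs_le.1 hprod).1
  have e : (d : ℝ) * θ ^ 2 * v = d * s := by rw [hs]; ring
  rw [e]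
  linarith

lemma exists_abs_nextMoment_three_le (hsum : π1 + π2 = 1) (h1 : 0 < π1) (h2 : 0 < π2) (d : ℕ) :
    ∃ K : ℝ, 0 ≤ K ∧ ∀ {Ω : Type} [Fintype Ω] (θ : ℝ) (p U : Ω → ℝ),
      StepData π1 π2 θ p U → |θ| ≤ 1 → ∀ ε : ℝ, 0 < ε → ε ≤ 1 →
        |nextMoment d π1 π2 θ p U 3| ≤ d * |θ| ^ 3 * |moment p U 3| +
          K * (ε * moment p U 2 + moment p U 2 ^ 2 / ε) := by
  obtain ⟨K1, hK1, e1⟩ := exists_diffSq_le hsum h1 h2 d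
  obtain ⟨K2, hK2, e2⟩ := exists_mixVar_le hsum h1 h2 d
  obtain ⟨K3, hK3, e3⟩ := exists_abs_diffCube_sub_le hsum h1 h2 d
  set H : ℝ := 1 + (1 + 1 / π1) ^ d + (1 + 1 / π2) ^ d with hH
  have hH0 : 0 ≤ H := by positivity
  refine ⟨K3 + H * (K1 + K2), by positivity, fun {Ω} _ θ p U h hθ ε hε hε1 => ?_⟩
  obtain ⟨b1, b2⟩ := h.scaled_moment_bounds hθ (r := 1) (by simpa using h.abs_moment_three_le)
  rw [one_mul] at b1
  have hv0 := h.moment_two_nonneg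
  have hv1 := h.moment_two_le_one
  have hs1 := b2.trans hv1
  have a1 := e1 _ _ b1 hs1
  have a2 := e2 _ _ b1 hs1
  have a3 := e3 _ _ b1 hs1
  have a4 := h.abs_nextMoment_three_sub_le hθ d hε
  rw [h.prodAvg_ratioDiff_sq, h.prodAvg_ratioDiff_cube, h.prodAvg_mixSum_sub_one_sq] at a4
  change |_ - (π1 * π2) ^ 3 * diffCube d π1 π2 _ _| ≤
    H * (ε * diffSq d π1 π2 _ _ + 1 / ε * mixVar d π1 π2 _ _) at a4
  set v := moment p U 2
  set s := θ ^ 2 * v with hs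
  set τ := θ ^ 3 * moment p U 3 with hτ
  have hs0 : 0 ≤ s := by positivity
  have hsv : s ^ 2 ≤ v ^ 2 := pow_le_pow_left₀ hs0 b2 2
  have c1 : ε * diffSq d π1 π2 s τ ≤ K1 * (ε * v) := by
    calc ε * diffSq d π1 π2 s τ ≤ ε * (K1 * s) := mul_le_mul_of_nonneg_left a1 hε.le
      _ ≤ ε * (K1 * v) := by gcongr
      _ = _ := by ring
  have c2 : 1 / ε * mixVar d π1 π2 s τ ≤ K2 * (v ^ 2 / ε) := by
    calc 1 / ε * mixVar d π1 π2 s τ ≤ 1 / ε * (K2 * s ^ 2) :=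
          mul_le_mul_of_nonneg_left a2 (by positivity)
      _ ≤ 1 / ε * (K2 * v ^ 2) := by gcongr
      _ = _ := by ring
  have p1 : 0 ≤ ε * v := by positivity
  have p2 : 0 ≤ v ^ 2 / ε := by positivity
  have c3 : K3 * s ^ 2 ≤ K3 * (ε * v + v ^ 2 / ε) := by
    refine mul_le_mul_of_nonneg_left ?_ hK3
    have : v ^ 2 ≤ v ^ 2 / ε := le_div_self (sq_nonneg v) hε hε1
    linarith
  have c4 : H * (ε * diffSq d π1 π2 s τ + 1 / ε * mixVar d π1 π2 s τ) ≤
      H * ((K1 + K2) * (ε * v + v ^ 2 / ε)) := by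
    refine mul_le_mul_of_nonneg_left ?_ hH0
    nlinarith [mul_nonneg hK1 p2, mul_nonneg hK2 p1]
  have c5 : |(d : ℝ) * τ| = d * |θ| ^ 3 * |moment p U 3| := by
    rw [hτ, abs_mul, abs_mul, abs_pow, Nat.abs_cast, mul_assoc]
  have tri : |nextMoment d π1 π2 θ p U 3| ≤
      |nextMoment d π1 π2 θ p U 3 - (π1 * π2) ^ 3 * diffCube d π1 π2 s τ| +
        |(π1 * π2) ^ 3 * diffCube d π1 π2 s τ - d * τ| + |(d : ℝ) * τ| := by
    refine le_trans (le_of_eq ?_) (abs_add_three _ _ _)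
    congr 1
    ring
  rw [c5] at tri
  linarith

lemma abs_le_three_quarters {d : ℕ} (hd : 2 ≤ d) {θ : ℝ} (h : (d : ℝ) * θ ^ 2 ≤ 1) :
    |θ| ≤ 3 / 4 := by
  have hd' : (2 : ℝ) ≤ d := by exact_mod_cast hd
  refine abs_le_of_sq_le_sq ?_ (by norm_num)
  nlinarith [sq_nonneg θ]

lemma exists_ratio_contraction (hsum : π1 + π2 = 1) (h1 : 0 < π1) (h2 : 0 < π2) {d : ℕ}
    (hd : 2 ≤ d) {κ : ℝ} (hκ : 0 < κ) :
    ∃ δ : ℝ, 0 < δ ∧ ∀ {Ω : Type} [Fintype Ω] (θ : ℝ) (p U : Ω → ℝ),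
      StepData π1 π2 θ p U → 1 / 2 ≤ (d : ℝ) * θ ^ 2 → (d : ℝ) * θ ^ 2 ≤ 1 →
        ∀ r : ℝ, 0 ≤ r → r ≤ 1 → moment p U 2 ≤ δ → |moment p U 3| ≤ r * moment p U 2 →
          |nextMoment d π1 π2 θ p U 3| ≤ (3 / 4 * r + κ) * nextMoment d π1 π2 θ p U 2 := by
  obtain ⟨K1, hK1, e1⟩ := exists_linear_le_nextMoment_two hsum h1 h2 d
  obtain ⟨K2, hK2, e2⟩ := exists_abs_nextMoment_three_le hsum h1 h2 d
  set ε : ℝ := min 1 (κ / (8 * (K2 + 1))) with hε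
  have hε0 : 0 < ε := by positivity
  have hεκ : K2 * ε ≤ κ / 8 := by
    calc K2 * ε ≤ (K2 + 1) * (κ / (8 * (K2 + 1))) :=
          mul_le_mul (by linarith) (min_le_right _ _) hε0.le (by positivity)
      _ = κ / 8 := by field_simp
  refine ⟨min (ε * κ / (8 * (K2 + 1))) (κ / (4 * (K1 + 1) * (1 + κ))), by positivity,
    fun {Ω} _ θ p U h hlow hup r hr0 hr1 hvδ hm => ?_⟩
  have hθ := abs_le_three_quarters hd hup
  have hθ1 : |θ| ≤ 1 := by linarith
  have b1 := e1 θ p U h hθ1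
  have b2 := e2 θ p U h hθ1 ε hε0 (min_le_left _ _)
  have hv0 := h.moment_two_nonneg
  set v := moment p U 2
  set t := (d : ℝ) * θ ^ 2 with ht
  have hv1 : K2 * (v / ε) ≤ κ / 8 := by
    calc K2 * (v / ε) ≤ (K2 + 1) * ((ε * κ / (8 * (K2 + 1))) / ε) := by
          refine mul_le_mul (by linarith) ?_ (by positivity) (by positivity)
          exact div_le_div_of_nonneg_right (hvδ.trans (min_le_left _ _)) hε0.le
      _ = κ / 8 := by field_simp
  have hv2 : K1 * v * (1 + κ) ≤ κ / 4 := by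
    calc K1 * v * (1 + κ) ≤ (K1 + 1) * (κ / (4 * (K1 + 1) * (1 + κ))) * (1 + κ) := by
          refine mul_le_mul_of_nonneg_right ?_ (by positivity)
          exact mul_le_mul (by linarith) (hvδ.trans (min_le_right _ _)) hv0 (by positivity)
      _ = κ / 4 := by field_simp
  have hcube : (d : ℝ) * |θ| ^ 3 * |moment p U 3| ≤ 3 / 4 * t * r * v := by
    calc (d : ℝ) * |θ| ^ 3 * |moment p U 3| = t * |θ| * |moment p U 3| := by
          rw [ht, ← sq_abs θ]; ring
      _ ≤ t * (3 / 4) * (r * v) := by gcongr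
      _ = _ := by ring
  have hrhs : (3 / 4 * r + κ) * (t * v - K1 * v ^ 2) ≤
      (3 / 4 * r + κ) * nextMoment d π1 π2 θ p U 2 :=
    mul_le_mul_of_nonneg_left b1 (by positivity)
  refine le_trans ?_ hrhs
  refine b2.trans ?_
  have hcoef : 3 / 4 * t * r + (K2 * ε + K2 * (v / ε)) ≤ (3 / 4 * r + κ) * (t - K1 * v) := by
    have q1 : κ / 2 ≤ κ * t := by nlinarith
    have q2 : (3 / 4 * r + κ) * (K1 * v) ≤ (1 + κ) * (K1 * v) :=
      mul_le_mul_of_nonneg_right (by linarith) (by positivity)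
    nlinarith
  have hmul := mul_le_mul_of_nonneg_right hcoef hv0
  have e : K2 * (ε * v + v ^ 2 / ε) = (K2 * ε + K2 * (v / ε)) * v := by ring
  rw [e]
  nlinarith

/-- After `k` generations the third moment of the posterior is at most
`(3/4)ᵏ` times the second, up to an arbitrarily small error. -/
lemma exists_third_moment_le (hsum : π1 + π2 = 1) (h1 : 0 < π1) (h2 : 0 < π2) {d : ℕ}
    (hd : 2 ≤ d) {κ : ℝ} (hκ : 0 < κ) (k : ℕ) :
    ∃ δ : ℝ, 0 < δ ∧ ∀ θ : ℝ, (∀ i j, 0 < Mmat θ (Dlt θ π1 π2) i j) →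
      1 / 2 ≤ (d : ℝ) * θ ^ 2 → (d : ℝ) * θ ^ 2 ≤ 1 → ∀ n : ℕ, k ≤ n →
        moment (levelProb d θ (Dlt θ π1 π2) n) (centeredPost d θ (Dlt θ π1 π2) n) 2 ≤ δ →
          |moment (levelProb d θ (Dlt θ π1 π2) n) (centeredPost d θ (Dlt θ π1 π2) n) 3| ≤
            ((3 / 4) ^ k + κ) *
              moment (levelProb d θ (Dlt θ π1 π2) n) (centeredPost d θ (Dlt θ π1 π2) n) 2 := by
  have hne : ∀ θ : ℝ, (d : ℝ) * θ ^ 2 ≤ 1 → θ ≠ 1 := fun θ hθ h => by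
    have := abs_le_three_quarters hd hθ
    rw [h] at this
    norm_num at this
  induction k with
  | zero =>
    refine ⟨1, one_pos, fun θ hM _ hup n _ _ => ?_⟩
    have h := stepData_level hsum h1 h2 (hne θ hup) hM d n
    refine h.abs_moment_three_le.trans (le_mul_of_one_le_left h.moment_two_nonneg ?_)
    simp [hκ.le]
  | succ k ih =>
    obtain ⟨δ1, hδ1, ih⟩ := ih
    obtain ⟨δ2, hδ2, hstep⟩ := exists_ratio_contraction hsum h1 h2 hd
      (by positivity : 0 < κ / 4)
    have hd' : (2 : ℝ) ≤ d := by exact_mod_cast hd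
    refine ⟨min δ1 δ2 / (2 * d), by positivity, fun θ hM hlow hup n hn hv => ?_⟩
    obtain ⟨n, rfl⟩ : ∃ m, n = m + 1 := ⟨n - 1, by omega⟩
    have h := stepData_level hsum h1 h2 (hne θ hup) hM d n
    have hback := h.theta_sq_mul_moment_le (⟨0, by omega⟩ : Fin d)
    rw [moment_level_succ hsum h1 h2 (hne θ hup) hM] at hv ⊢
    rw [moment_level_succ hsum h1 h2 (hne θ hup) hM]
    have hv0 := h.moment_two_nonneg
    have hprev : moment (levelProb d θ (Dlt θ π1 π2) n)
        (centeredPost d θ (Dlt θ π1 π2) n) 2 ≤ min δ1 δ2 := by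
      have a := hback.trans hv
      rw [le_div_iff₀ (by positivity)] at a
      nlinarith
    have hm := ih θ hM hlow hup n (by omega) (hprev.trans (min_le_left _ _))
    set v := moment (levelProb d θ (Dlt θ π1 π2) n) (centeredPost d θ (Dlt θ π1 π2) n) 2
    have hm' : |moment (levelProb d θ (Dlt θ π1 π2) n)
        (centeredPost d θ (Dlt θ π1 π2) n) 3| ≤ min 1 ((3 / 4) ^ k + κ) * v := by
      rcases min_choice 1 ((3 / 4) ^ k + κ) with e | e <;> rw [e]
      · rw [one_mul]
        exact h.abs_moment_three_le
      · exact hm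
    refine (hstep θ _ _ h hlow hup _ (by positivity) (min_le_left _ _)
      (hprev.trans (min_le_right _ _)) hm').trans ?_
    refine mul_le_mul_of_nonneg_right ?_ ((by positivity : 0 ≤ θ ^ 2 * v).trans hback)
    have := min_le_right 1 ((3 / 4) ^ k + κ)
    rw [pow_succ]
    linarith

end Recursion

/-- Assume `6π₁π₂ < 1` and `1/2 ≤ dθ² ≤ 1`. There exist `N = N(π)` and
`δ = δ(π, d) > 0` such that for every `n ≥ N` with `x_n ≤ δ`,
`x_{n+1} ≥ dθ²x_n + (1/2)·((1−6π₁π₂)/(π₁π₂²))·(d(d−1)/2)·θ⁴·x_n²`. -/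
theorem xseq_recursive_lower_bound (π1 π2 : ℝ) (hsum : π1 + π2 = 1) (hord : π2 ≤ π1)
    (hpi2 : 0 < π2) (h6 : 6 * π1 * π2 < 1) :
    ∃ N : ℕ, ∀ d : ℕ, 2 ≤ d → ∃ δ : ℝ, 0 < δ ∧
      ∀ θ : ℝ, θ ≠ 0 → (∀ i j, 0 < Mmat θ (Dlt θ π1 π2) i j) →
        1 / 2 ≤ (d : ℝ) * θ ^ 2 → (d : ℝ) * θ ^ 2 ≤ 1 →
        ∀ n : ℕ, N ≤ n → xseq d θ (Dlt θ π1 π2) n ≤ δ →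
          (d : ℝ) * θ ^ 2 * xseq d θ (Dlt θ π1 π2) n +
              (1 / 2) * ((1 - 6 * π1 * π2) / (π1 * π2 ^ 2)) *
                ((d : ℝ) * ((d : ℝ) - 1) / 2) * θ ^ 4 * xseq d θ (Dlt θ π1 π2) n ^ 2 ≤
            xseq d θ (Dlt θ π1 π2) (n + 1) := by
  have hpi1 : 0 < π1 := by linarith
  obtain ⟨C, hC, hvar⟩ := exists_le_varLower hsum hpi1 hpi2
  set c : ℝ := (1 - 6 * π1 * π2) / (π1 * π2) ^ 2 with hc
  have hc0 : 0 < c := div_pos (by linarith) (by positivity)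
  set η : ℝ := min 1 (c / (4 * (C + 1))) with hη
  have hη0 : 0 < η := by positivity
  have hCη : C * η ≤ c / 4 := by
    calc C * η ≤ (C + 1) * (c / (4 * (C + 1))) :=
          mul_le_mul (by linarith) (min_le_right _ _) hη0.le (by positivity)
      _ = c / 4 := by field_simp
  obtain ⟨N, hN⟩ := exists_pow_lt_of_lt_one (half_pos hη0) (by norm_num : (3 / 4 : ℝ) < 1)
  refine ⟨N, fun d hd => ?_⟩
  obtain ⟨K, hK, hvar⟩ := hvar d
  obtain ⟨δ, hδ, hthird⟩ := exists_third_moment_le hsum hpi1 hpi2 hd (half_pos hη0) N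
  refine ⟨min δ (c / (4 * (K + 1))) / π1, by positivity,
    fun θ _ hM hlow hup n hn hx => ?_⟩
  have hθ := abs_le_three_quarters hd hup
  have hne : θ ≠ 1 := by
    rintro rfl
    norm_num at hθ
  have h := stepData_level hsum hpi1 hpi2 hne hM d n
  rw [xseq_eq_moment_div hsum hpi1 hpi2 hne hM, div_le_div_iff_of_pos_right hpi1] at hx
  rw [xseq_eq_moment_div hsum hpi1 hpi2 hne hM, xseq_eq_moment_div hsum hpi1 hpi2 hne hM,
    moment_level_succ hsum hpi1 hpi2 hne hM]
  have hm := hthird θ hM hlow hup n hn (hx.trans (min_le_left _ _))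
  have hv0 := h.moment_two_nonneg
  have hm' : |moment (levelProb d θ (Dlt θ π1 π2) n) (centeredPost d θ (Dlt θ π1 π2) n) 3| ≤
      η * moment (levelProb d θ (Dlt θ π1 π2) n) (centeredPost d θ (Dlt θ π1 π2) n) 2 :=
    hm.trans (mul_le_mul_of_nonneg_right (by linarith) hv0)
  obtain ⟨b1, b2⟩ := h.scaled_moment_bounds (by linarith) hm'
  have hs0 : 0 ≤ θ ^ 2 *
      moment (levelProb d θ (Dlt θ π1 π2) n) (centeredPost d θ (Dlt θ π1 π2) n) 2 := by
    positivity
  have hmain := (hvar _ _ (b1.trans (mul_le_of_le_one_left hs0 (min_le_left _ _)))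
    (b2.trans h.moment_two_le_one)).trans (h.varLower_le_nextMoment d)
  have hvc := hx.trans (min_le_right _ _)
  set v := moment (levelProb d θ (Dlt θ π1 π2) n) (centeredPost d θ (Dlt θ π1 π2) n) 2
  set s := θ ^ 2 * v with hs
  set τ := θ ^ 3 *
    moment (levelProb d θ (Dlt θ π1 π2) n) (centeredPost d θ (Dlt θ π1 π2) n) 3
  have hd' : (2 : ℝ) ≤ d := by exact_mod_cast hd
  have hD : (1 : ℝ) ≤ d * (d - 1) / 2 := by nlinarith
  have hKs : K * s ≤ c / 4 := by
    calc K * s ≤ (K + 1) * (c / (4 * (K + 1))) :=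
          mul_le_mul (by linarith) (b2.trans hvc) hs0 (by positivity)
      _ = c / 4 := by field_simp
  have hcube : K * s ^ 3 ≤ (d : ℝ) * (d - 1) / 2 * (c / 4 * s ^ 2) := by
    calc K * s ^ 3 = K * s * s ^ 2 := by ring
      _ ≤ c / 4 * s ^ 2 := mul_le_mul_of_nonneg_right hKs (sq_nonneg s)
      _ ≤ _ := le_mul_of_one_le_left (by positivity) hD
  have hcross : C * (s * |τ|) ≤ c / 4 * s ^ 2 := by
    calc C * (s * |τ|) ≤ C * (s * (η * s)) := by gcongr
      _ = C * η * s ^ 2 := by ring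
      _ ≤ _ := mul_le_mul_of_nonneg_right hCη (sq_nonneg s)
  have hcross' := mul_le_mul_of_nonneg_left hcross (zero_le_one.trans hD)
  have hfinal : d * s + (d : ℝ) * (d - 1) / 2 * (c / 2 * s ^ 2) ≤
      nextMoment d π1 π2 θ (levelProb d θ (Dlt θ π1 π2) n)
        (centeredPost d θ (Dlt θ π1 π2) n) 2 := by
    linarith
  rw [le_div_iff₀ hpi1]
  refine le_trans (le_of_eq ?_) hfinal
  rw [hs, hc]
  field_simp

end AsymIsing
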